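/- arXiv:1809.10263 — 5 statements merged into one kernel-verified Lean document; each statement's English description precedes it below -/
import Mathlib

section
/- The number of shellings of the complete bipartite graph K_{m,n} equals m! · n! · (mn)! / (m+n-1)!. -/
open SimpleGraph Finset Nat

/-- A set of edges forms a connected (sub)graph: the graph it spans,
induced on its support, is connected. -/
def EdgeSetConnected (V : Type*) (S : Set (Sym2 V)) : Prop :=
  ((SimpleGraph.fromEdgeSet S).induce (SimpleGraph.fromEdgeSet S).support).Connected

/-- A shelling of a graph `G`: an ordering of its edges such that every
initial segment forms a connected subgraph. -/
def IsShelling {V : Type*} (G : SimpleGraph V)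
    (σ : Fin (Nat.card G.edgeSet) ≃ G.edgeSet) : Prop :=
  ∀ k : Fin (Nat.card G.edgeSet),
    EdgeSetConnected V {e | ∃ i, i ≤ k ∧ (σ i : Sym2 V) = e}

/-- The number of shellings of `G`. -/
noncomputable def shellingCount {V : Type*} (G : SimpleGraph V) : ℕ :=
  Nat.card {σ : Fin (Nat.card G.edgeSet) ≃ G.edgeSet // IsShelling G σ}

/-- The number of shellings of `G` rooted at `v`, i.e. whose first edge is incident to `v`. -/
noncomputable def rootedShellingCount {V : Type*} (G : SimpleGraph V) (v : V) : ℕ :=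
  Nat.card {σ : Fin (Nat.card G.edgeSet) ≃ G.edgeSet //
    IsShelling G σ ∧ ∃ h : 0 < Nat.card G.edgeSet, v ∈ (σ ⟨0, h⟩ : Sym2 V)}

/-- The number of vertices of the subtree rooted at `u` when the tree `G` is
rooted at `v`: vertices `w` such that `u` lies on the (unique) path from `v` to `w`. -/
noncomputable def subtreeSize {V : Type*} (G : SimpleGraph V) (v u : V) : ℕ :=
  Nat.card {w : V | ∀ p : G.Path v w, u ∈ (p : G.Walk v w).support}

namespace ShellKmn

/-- edge of the complete bipartite graph -/
def ed {m n : ℕ} (e : Fin m × Fin n) : Sym2 (Fin m ⊕ Fin n) := s(Sum.inl e.1, Sum.inr e.2)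

lemma ed_inj {m n : ℕ} : Function.Injective (ed (m := m) (n := n)) := by
  rintro ⟨a, b⟩ ⟨c, d⟩ h
  simpa [ed] using h

def share {m n : ℕ} (e e' : Fin m × Fin n) : Prop := e.1 = e'.1 ∨ e.2 = e'.2

def gr {m n : ℕ} (S : Set (Fin m × Fin n)) : SimpleGraph (Fin m ⊕ Fin n) :=
  SimpleGraph.fromEdgeSet (ed '' S)

lemma gr_adj_lr {m n : ℕ} (S : Set (Fin m × Fin n)) (x : Fin m) (y : Fin n) :
    (gr S).Adj (Sum.inl x) (Sum.inr y) ↔ (x, y) ∈ S := by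
  simp [gr, ed]

lemma gr_adj {m n : ℕ} (S : Set (Fin m × Fin n)) (u v : Fin m ⊕ Fin n) :
    (gr S).Adj u v ↔ ∃ e ∈ S, (u = Sum.inl e.1 ∧ v = Sum.inr e.2) ∨
      (v = Sum.inl e.1 ∧ u = Sum.inr e.2) := by
  rcases u with x | y <;> rcases v with x' | y' <;> simp [gr, ed]

lemma conn_iff {V : Type*} (H : SimpleGraph V) :
    (H.induce H.support).Connected ↔
      ∃ u ∈ H.support, ∀ v ∈ H.support, H.Reachable u v := by
  have key : ∀ (u : V) (hu : u ∈ H.support) (v : V), H.Reachable u v →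
      ∃ hv : v ∈ H.support, (H.induce H.support).Reachable ⟨u, hu⟩ ⟨v, hv⟩ := by
    intro u hu v h
    rw [SimpleGraph.reachable_iff_reflTransGen] at h
    induction h with
    | refl => exact ⟨hu, SimpleGraph.Reachable.refl _⟩
    | tail _ hbc ih =>
      obtain ⟨hb, hr⟩ := ih
      refine ⟨⟨_, hbc.symm⟩, hr.trans (SimpleGraph.Adj.reachable ?_)⟩
      simpa using hbc
  rw [SimpleGraph.connected_iff_exists_forall_reachable]
  constructor
  · rintro ⟨⟨u, hu⟩, h⟩
    refine ⟨u, hu, fun v hv => ?_⟩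
    exact (h ⟨v, hv⟩).map (SimpleGraph.Embedding.induce _).toHom
  · rintro ⟨u, hu, h⟩
    refine ⟨⟨u, hu⟩, ?_⟩
    rintro ⟨v, hv⟩
    exact (key u hu v (h v hv)).2

def Conn {m n : ℕ} (S : Set (Fin m × Fin n)) : Prop :=
  ∃ u ∈ (gr S).support, ∀ v ∈ (gr S).support, (gr S).Reachable u v

lemma edgeSetConnected_iff {m n : ℕ} (S : Set (Fin m × Fin n)) :
    EdgeSetConnected _ (ed '' S) ↔ Conn S := conn_iff _

lemma mem_supp {m n : ℕ} (S : Set (Fin m × Fin n)) (u : Fin m ⊕ Fin n) :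
    u ∈ (gr S).support ↔ ∃ e ∈ S, u = Sum.inl e.1 ∨ u = Sum.inr e.2 := by
  rw [SimpleGraph.mem_support]
  constructor
  · rintro ⟨v, hv⟩
    rw [gr_adj] at hv
    obtain ⟨e, he, h | h⟩ := hv
    · exact ⟨e, he, Or.inl h.1⟩
    · exact ⟨e, he, Or.inr h.2⟩
  · rintro ⟨e, he, rfl | rfl⟩
    · exact ⟨Sum.inr e.2, (gr_adj_lr S _ _).2 he⟩
    · exact ⟨Sum.inl e.1, ((gr_adj_lr S _ _).2 he).symm⟩

lemma conn_singleton {m n : ℕ} (e : Fin m × Fin n) : Conn {e} := by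
  refine ⟨Sum.inl e.1, (mem_supp _ _).2 ⟨e, rfl, Or.inl rfl⟩, ?_⟩
  intro v hv
  obtain ⟨e', he', h⟩ := (mem_supp _ _).1 hv
  obtain rfl : e' = e := he'
  rcases h with rfl | rfl
  · exact SimpleGraph.Reachable.refl _
  · exact SimpleGraph.Adj.reachable ((gr_adj_lr _ _ _).2 rfl)

lemma conn_insert {m n : ℕ} (S : Set (Fin m × Fin n)) (e e' : Fin m × Fin n)
    (hS : Conn S) (he' : e' ∈ S) (hs : share e' e) : Conn (insert e S) := by
  obtain ⟨u, hu, h⟩ := hS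
  have hle : gr S ≤ gr (insert e S) := by
    intro a b hab
    rw [gr_adj] at hab ⊢
    obtain ⟨e, he, h⟩ := hab
    exact ⟨e, Set.mem_insert_of_mem _ he, h⟩
  have hE : (gr (insert e S)).Adj (Sum.inl e.1) (Sum.inr e.2) :=
    (gr_adj_lr _ _ _).2 (Set.mem_insert _ _)
  have old : ∀ v ∈ (gr S).support, (gr (insert e S)).Reachable u v :=
    fun v hv => (h v hv).mono hle
  have h1 := old _ ((mem_supp S _).2 ⟨e', he', Or.inl rfl⟩)
  have h2 := old _ ((mem_supp S _).2 ⟨e', he', Or.inr rfl⟩)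
  have both : (gr (insert e S)).Reachable u (Sum.inl e.1) ∧
      (gr (insert e S)).Reachable u (Sum.inr e.2) := by
    rcases hs with hs | hs
    · rw [hs] at h1
      exact ⟨h1, h1.trans hE.reachable⟩
    · rw [hs] at h2
      exact ⟨h2.trans hE.symm.reachable, h2⟩
  refine ⟨u, ?_, ?_⟩
  · rw [mem_supp] at hu ⊢
    obtain ⟨e, he, h⟩ := hu
    exact ⟨e, Set.mem_insert_of_mem _ he, h⟩
  · intro v hv
    obtain ⟨e1, he1, h⟩ := (mem_supp _ _).1 hv
    rcases he1 with rfl | he1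
    · rcases h with rfl | rfl
      · exact both.1
      · exact both.2
    · exact old v ((mem_supp _ _).2 ⟨e1, he1, h⟩)

lemma share_of_conn {m n : ℕ} (S : Set (Fin m × Fin n)) (e : Fin m × Fin n)
    (hS : Conn (insert e S)) (hne : S.Nonempty) : ∃ e' ∈ S, share e' e := by
  by_contra hcon
  push Not at hcon
  obtain ⟨e', he'⟩ := hne
  obtain ⟨u, hu, h⟩ := hS
  have r : (gr (insert e S)).Reachable (Sum.inl e.1) (Sum.inl e'.1) :=
    (h _ ((mem_supp _ _).2 ⟨e, Set.mem_insert _ _, Or.inl rfl⟩)).symm.trans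
    (h _ ((mem_supp _ _).2 ⟨e', Set.mem_insert_of_mem _ he', Or.inl rfl⟩))
  have inv : ∀ v, (gr (insert e S)).Reachable (Sum.inl e.1) v →
      v = Sum.inl e.1 ∨ v = Sum.inr e.2 := by
    intro v hv
    rw [SimpleGraph.reachable_iff_reflTransGen] at hv
    induction hv with
    | refl => exact Or.inl rfl
    | tail _ hbc ih =>
      rw [gr_adj] at hbc
      obtain ⟨e1, he1, h1⟩ := hbc
      rcases he1 with rfl | he1
      · rcases h1 with h1 | h1
        · exact Or.inr h1.2
        · exact Or.inl h1.1
      · exfalso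
        apply hcon e1 he1
        rcases h1 with ⟨h1, -⟩ | ⟨-, h1⟩ <;> rcases ih with h2 | h2 <;> rw [h1] at h2
        · exact Or.inl (Sum.inl_injective h2)
        · cases h2
        · cases h2
        · exact Or.inr (Sum.inr_injective h2)
  rcases inv _ r with h | h
  · exact hcon e' he' (Or.inl (Sum.inl_injective h))
  · cases h

/-- every edge after the first shares a vertex with an earlier one -/
def Good {m n k : ℕ} (f : Fin k → Fin m × Fin n) : Prop :=
  ∀ i : Fin k, 0 < i.1 → ∃ j, j < i ∧ share (f j) (f i)

lemma good_iff {m n k : ℕ} (f : Fin k → Fin m × Fin n) :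
    (∀ i : Fin k, Conn (f '' {j | j ≤ i})) ↔ Good f := by
  have ins : ∀ (i : ℕ) (hi : i + 1 < k), f '' {j | j ≤ ⟨i + 1, hi⟩} =
      insert (f ⟨i + 1, hi⟩) (f '' {j | j ≤ ⟨i, by omega⟩}) := by
    intro i hi
    rw [← Set.image_insert_eq]
    congr 1
    ext j
    simp only [Set.mem_ofPred_eq, Set.mem_insert_iff, Fin.le_def, Fin.ext_iff]
    omega
  constructor
  · intro h i hi
    obtain ⟨i, hik⟩ := i
    obtain ⟨i, rfl⟩ : ∃ i', i = i' + 1 := ⟨i - 1, by simp at hi; omega⟩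
    have := h ⟨i + 1, hik⟩
    rw [ins] at this
    obtain ⟨e', ⟨j, hj, rfl⟩, hs⟩ := share_of_conn _ _ this ⟨_, ⟨i, by omega⟩, by simp, rfl⟩
    refine ⟨j, ?_, hs⟩
    simp only [Set.mem_ofPred_eq, Fin.le_def] at hj
    simp only [Fin.lt_def]
    omega
  · rintro h ⟨i, hi⟩
    induction i with
    | zero =>
      have : f '' {j | j ≤ ⟨0, hi⟩} = {f ⟨0, hi⟩} := by
        rw [← Set.image_singleton]
        congr 1
        ext j
        simp [Fin.le_def, Fin.ext_iff]
      rw [this]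
      exact conn_singleton _
    | succ i ih =>
      rw [ins]
      obtain ⟨j, hj, hs⟩ := h ⟨i + 1, hi⟩ (by simp)
      refine conn_insert _ _ (f j) (ih (by omega)) ⟨j, ?_, rfl⟩ hs
      simp only [Fin.lt_def] at hj
      simp only [Set.mem_ofPred_eq, Fin.le_def]
      omega

def Valid {m n k : ℕ} (f : Fin k → Fin m × Fin n) : Prop := Function.Injective f ∧ Good f

noncomputable def edgeEquiv (m n : ℕ) :
    (Fin m × Fin n) ≃ (completeBipartiteGraph (Fin m) (Fin n)).edgeSet :=
  Equiv.ofBijective (fun e => ⟨ed e, by simp [ed]⟩) (by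
    constructor
    · intro a b h
      exact ed_inj (congrArg Subtype.val h)
    · rintro ⟨e, he⟩
      induction e with
      | _ u v =>
      rcases u with x | y <;> rcases v with x' | y' <;> simp at he
      · exact ⟨(x, y'), rfl⟩
      · exact ⟨(x', y), Subtype.ext Sym2.eq_swap⟩)

lemma edgeEquiv_val {m n : ℕ} (e : Fin m × Fin n) : (edgeEquiv m n e : Sym2 _) = ed e := rfl

lemma card_edge (m n : ℕ) :
    Nat.card (completeBipartiteGraph (Fin m) (Fin n)).edgeSet = m * n := by
  rw [← Nat.card_congr (edgeEquiv m n)]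
  simp

lemma shellingCount_eq (m n : ℕ) :
    shellingCount (completeBipartiteGraph (Fin m) (Fin n)) =
      Nat.card {f : Fin (m * n) → Fin m × Fin n // Valid f} := by
  rw [← card_edge m n]
  unfold shellingCount
  have hsh : ∀ σ, IsShelling (completeBipartiteGraph (Fin m) (Fin n)) σ ↔
      Good (fun i => (edgeEquiv m n).symm (σ i)) := by
    intro σ
    rw [← good_iff]
    unfold IsShelling
    refine forall_congr' fun k => ?_
    rw [← edgeSetConnected_iff]
    have : {e | ∃ i, i ≤ k ∧ (σ i : Sym2 (Fin m ⊕ Fin n)) = e} =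
        ed '' ((fun i => (edgeEquiv m n).symm (σ i)) '' {j | j ≤ k}) := by
      ext e
      simp [← edgeEquiv_val]
    rw [this]
  refine Nat.card_congr (Equiv.ofBijective
    (fun σ => ⟨fun i => (edgeEquiv m n).symm (σ.1 i), ?_, (hsh _).1 σ.2⟩) ⟨?_, ?_⟩)
  · exact (edgeEquiv m n).symm.injective.comp σ.1.injective
  · intro σ τ h
    apply Subtype.ext
    ext1 i
    exact (edgeEquiv m n).symm.injective (congrFun (congrArg Subtype.val h) i)
  · rintro ⟨f, hf, hg⟩
    have hb : Function.Bijective f := by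
      rw [Fintype.bijective_iff_injective_and_card]
      refine ⟨hf, ?_⟩
      rw [Fintype.card_fin, card_edge]
      simp
    have hEq : (fun i => (edgeEquiv m n).symm (((Equiv.ofBijective f hb).trans (edgeEquiv m n)) i))
        = f := by
      funext i
      exact (edgeEquiv m n).symm_apply_apply (f i)
    refine ⟨⟨(Equiv.ofBijective f hb).trans (edgeEquiv m n), (hsh _).2 ?_⟩, ?_⟩
    · rw [hEq]; exact hg
    · exact Subtype.ext hEq

/-- weight -/
noncomputable def g (m n a b : ℕ) : ℚ :=
  ((n - 1 + a)! * (m - 1 + b)! : ℚ) / ((a + b - 1)! * (m + n - 1)! : ℚ)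

lemma g_rec (m n a b : ℕ) (hm : 0 < m) (hn : 0 < n) (ha : 0 < a) (hb : 0 < b) :
    ((m : ℚ) * n - a * b) * g m n a b =
      ((m : ℚ) - a) * b * g m n (a + 1) b + a * ((n : ℚ) - b) * g m n a (b + 1) := by
  obtain ⟨m, rfl⟩ : ∃ k, m = k + 1 := ⟨m - 1, by omega⟩
  obtain ⟨n, rfl⟩ : ∃ k, n = k + 1 := ⟨n - 1, by omega⟩
  obtain ⟨a, rfl⟩ : ∃ k, a = k + 1 := ⟨a - 1, by omega⟩
  obtain ⟨b, rfl⟩ : ∃ k, b = k + 1 := ⟨b - 1, by omega⟩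
  unfold g
  have e1 : a + 1 + (b + 1) - 1 = a + b + 1 := by omega
  have e2 : a + 1 + 1 + (b + 1) - 1 = a + b + 1 + 1 := by omega
  have e3 : a + 1 + (b + 1 + 1) - 1 = a + b + 1 + 1 := by omega
  have e4 : m + 1 + (n + 1) - 1 = m + n + 1 := by omega
  have e5 : n + 1 - 1 + (a + 1) = n + a + 1 := by omega
  have e6 : n + 1 - 1 + (a + 1 + 1) = n + a + 1 + 1 := by omega
  have e7 : m + 1 - 1 + (b + 1) = m + b + 1 := by omega
  have e8 : m + 1 - 1 + (b + 1 + 1) = m + b + 1 + 1 := by omega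
  rw [e1, e2, e3, e4, e5, e6, e7, e8, Nat.factorial_succ (a + b + 1),
    Nat.factorial_succ (n + a + 1), Nat.factorial_succ (m + b + 1)]
  have h1 : ((a + b + 1)! : ℚ) ≠ 0 := by positivity
  have h2 : ((m + n + 1)! : ℚ) ≠ 0 := by positivity
  have h3 : ((a : ℚ) + b + 1 + 1) ≠ 0 := by positivity
  push_cast
  field_simp
  ring

open Classical in
lemma sum_step (m n : ℕ) (hm : 0 < m) (hn : 0 < n) (S : Finset (Fin m × Fin n))
    (hS : S.Nonempty) :
    ∑ e : Fin m × Fin n, (if e ∉ S ∧ ∃ e' ∈ S, share e' e then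
        g m n (insert e.1 (S.image Prod.fst)).card (insert e.2 (S.image Prod.snd)).card else 0)
      = ((m : ℚ) * n - S.card) * g m n (S.image Prod.fst).card (S.image Prod.snd).card := by
  set A := S.image Prod.fst with hA
  set B := S.image Prod.snd with hB
  have hsh : ∀ e, (∃ e' ∈ S, share e' e) ↔ e.1 ∈ A ∨ e.2 ∈ B := by
    intro e
    simp only [share, hA, hB, Finset.mem_image]
    constructor
    · rintro ⟨e', h, h1 | h1⟩
      · exact Or.inl ⟨e', h, h1⟩
      · exact Or.inr ⟨e', h, h1⟩
    · rintro (⟨e', h, h1⟩ | ⟨e', h, h1⟩)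
      · exact ⟨e', h, Or.inl h1⟩
      · exact ⟨e', h, Or.inr h1⟩
  have hSA : ∀ e ∈ S, e.1 ∈ A ∧ e.2 ∈ B := fun e he =>
    ⟨Finset.mem_image_of_mem _ he, Finset.mem_image_of_mem _ he⟩
  have term : ∀ e : Fin m × Fin n, (if e ∉ S ∧ ∃ e' ∈ S, share e' e then
        g m n (insert e.1 A).card (insert e.2 B).card else 0) =
      (if e ∈ A ×ˢ B then g m n A.card B.card else 0) - (if e ∈ S then g m n A.card B.card else 0)
      + (if e ∈ Aᶜ ×ˢ B then g m n (A.card + 1) B.card else 0)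
      + (if e ∈ A ×ˢ Bᶜ then g m n A.card (B.card + 1) else 0) := by
    intro e
    simp only [hsh]
    simp only [Finset.mem_product, Finset.mem_compl]
    by_cases h1 : e.1 ∈ A <;> by_cases h2 : e.2 ∈ B <;> by_cases h3 : e ∈ S <;>
      simp [h1, h2, h3, Finset.card_insert_of_notMem] <;> simp_all
  rw [Finset.sum_congr rfl fun e _ => term e]
  simp only [Finset.sum_add_distrib, Finset.sum_sub_distrib, Finset.sum_ite_mem, Finset.univ_inter,
    Finset.sum_const, Finset.card_product, Finset.card_compl, Fintype.card_fin, nsmul_eq_mul]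
  have hAm : A.card ≤ m := by simpa using A.card_le_univ
  have hBn : B.card ≤ n := by simpa using B.card_le_univ
  push_cast [hAm, hBn]
  have := g_rec m n A.card B.card hm hn (hS.image _).card_pos (hS.image _).card_pos
  linarith

open Classical in
lemma valid_snoc {m n k : ℕ} (hk : 0 < k) (f : Fin k → Fin m × Fin n) (e : Fin m × Fin n) :
    Valid (Fin.snoc f e : Fin (k + 1) → Fin m × Fin n) ↔
      Valid f ∧ (e ∉ univ.image f ∧ ∃ e' ∈ univ.image f, share e' e) := by
  unfold Valid
  rw [Fin.snoc_injective_iff]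
  have : Good (Fin.snoc f e : Fin (k + 1) → Fin m × Fin n) ↔
      Good f ∧ ∃ e' ∈ univ.image f, share e' e := by
    unfold Good
    rw [Fin.forall_fin_succ']
    apply and_congr
    · refine forall_congr' fun i => ?_
      refine imp_congr Iff.rfl ?_
      rw [Fin.exists_fin_succ']
      have hl : ¬ (Fin.last k < i.castSucc) := not_lt.2 (Fin.le_last _)
      simp [hl]
    · rw [Fin.exists_fin_succ']
      simp [hk, Fin.castSucc_lt_last]
  rw [this]
  simp only [Set.mem_range, Finset.mem_image, Finset.mem_univ, true_and]
  tauto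

open Classical in
noncomputable def Phi (m n k : ℕ) : ℚ :=
  ∑ f : Fin k → Fin m × Fin n, if Valid f then
    ((m * n - k)! : ℚ) * g m n (univ.image fun i => (f i).1).card (univ.image fun i => (f i).2).card
    else 0

open Classical in
lemma Phi_succ (m n k : ℕ) (hm : 0 < m) (hn : 0 < n) (hk : 0 < k) (hkN : k < m * n) :
    Phi m n (k + 1) = Phi m n k := by
  unfold Phi
  rw [← (Fin.snocEquiv (fun _ : Fin (k + 1) => Fin m × Fin n)).sum_comp, Fintype.sum_prod_type,
    Finset.sum_comm]
  refine Finset.sum_congr rfl fun f _ => ?_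
  simp only [Fin.snocEquiv, Equiv.coe_fn_mk]
  by_cases hf : Valid f
  · simp only [valid_snoc hk, hf, true_and, if_true]
    have i1 : ∀ e, (univ.image fun i => ((Fin.snoc f e : Fin (k + 1) → Fin m × Fin n) i).1) =
        insert e.1 ((univ.image f).image Prod.fst) := by
      intro e; ext x
      rw [Finset.image_image]
      simp [Fin.exists_fin_succ', or_comm, eq_comm]
    have i2 : ∀ e, (univ.image fun i => ((Fin.snoc f e : Fin (k + 1) → Fin m × Fin n) i).2) =
        insert e.2 ((univ.image f).image Prod.snd) := by
      intro e; ext x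
      rw [Finset.image_image]
      simp [Fin.exists_fin_succ', or_comm, eq_comm]
    have hne : (univ.image f).Nonempty := ⟨f ⟨0, hk⟩, by simp⟩
    have hs := sum_step m n hm hn (univ.image f) hne
    have hc : (univ.image f).card = k := by
      rw [Finset.card_image_of_injective _ hf.1]; simp
    simp only [i1, i2]
    rw [hc] at hs
    have hfac : ((m * n - k)! : ℚ) = ((m : ℚ) * n - k) * ((m * n - (k + 1))! : ℚ) := by
      obtain ⟨d, hd⟩ : ∃ d, m * n = k + 1 + d := ⟨m * n - (k + 1), by omega⟩
      have h1 : m * n - k = d + 1 := by omega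
      have h2 : m * n - (k + 1) = d := by omega
      rw [h1, h2, Nat.factorial_succ]
      have : (m : ℚ) * n = k + 1 + d := by exact_mod_cast hd
      rw [this]; push_cast; ring
    have a1 : (univ.image fun i => (f i).1) = (univ.image f).image Prod.fst := by
      rw [Finset.image_image]; rfl
    have a2 : (univ.image fun i => (f i).2) = (univ.image f).image Prod.snd := by
      rw [Finset.image_image]; rfl
    rw [a1, a2, hfac, mul_assoc, mul_left_comm, ← hs, Finset.mul_sum]
    refine Finset.sum_congr rfl fun e _ => ?_
    rw [mul_ite, mul_zero]
  · simp [valid_snoc hk, hf]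

lemma Phi_one (m n : ℕ) :
    Phi m n 1 = (m * n : ℚ) * ((m * n - 1)! * g m n 1 1) := by
  unfold Phi
  have hv : ∀ f : Fin 1 → Fin m × Fin n, Valid f := by
    intro f
    refine ⟨Function.injective_of_subsingleton f, ?_⟩
    intro i hi
    omega
  simp [hv]

lemma Phi_eq (m n k : ℕ) (hm : 0 < m) (hn : 0 < n) (hk : 0 < k) (hkN : k ≤ m * n) :
    Phi m n k = Phi m n 1 := by
  induction k, hk using Nat.le_induction with
  | base => rfl
  | succ k hk ih => rw [Phi_succ m n k hm hn hk (by omega), ih (by omega)]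

open Classical in
lemma Phi_top (m n : ℕ) (hm : 0 < m) (hn : 0 < n) :
    Phi m n (m * n) = Nat.card {f : Fin (m * n) → Fin m × Fin n // Valid f} := by
  rw [Nat.card_eq_fintype_card, Fintype.card_subtype, Finset.card_filter]
  unfold Phi
  push_cast
  refine Finset.sum_congr rfl fun f _ => ?_
  by_cases hf : Valid f
  · have hs : Function.Surjective f := by
      refine ((Fintype.bijective_iff_injective_and_card f).2 ⟨hf.1, by simp⟩).2
    have a1 : (univ.image fun i => (f i).1) = univ := by
      ext x
      obtain ⟨i, hi⟩ := hs (x, ⟨0, hn⟩)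
      simp only [Finset.mem_image, Finset.mem_univ, true_and, iff_true]
      exact ⟨i, by rw [hi]⟩
    have a2 : (univ.image fun i => (f i).2) = univ := by
      ext x
      obtain ⟨i, hi⟩ := hs (⟨0, hm⟩, x)
      simp only [Finset.mem_image, Finset.mem_univ, true_and, iff_true]
      exact ⟨i, by rw [hi]⟩
    simp only [hf, if_true, a1, a2]
    have e1 : n - 1 + m = m + n - 1 := by omega
    have e2 : m - 1 + n = m + n - 1 := by omega
    have h1 : ((m + n - 1)! : ℚ) ≠ 0 := by positivity
    simp [g, e1, e2, h1]
  · simp [hf]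

end ShellKmn

/-- The number of shellings of the complete bipartite graph `K_{m,n}` equals
`m! n! (mn)! / (m+n-1)!` (stated multiplicatively). -/
theorem shellingCount_completeBipartiteGraph (m n : ℕ) (hm : 0 < m) (hn : 0 < n) :
    shellingCount (completeBipartiteGraph (Fin m) (Fin n)) * (m + n - 1)! =
      m ! * n ! * (m * n)! := by
  have h := (ShellKmn.Phi_top m n hm hn).symm.trans
    (ShellKmn.Phi_eq m n (m * n) hm hn (Nat.mul_pos hm hn) le_rfl)
  rw [← ShellKmn.shellingCount_eq, ShellKmn.Phi_one] at h
  have hq : (shellingCount (completeBipartiteGraph (Fin m) (Fin n)) : ℚ) * ((m + n - 1)! : ℚ) =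
      (m ! : ℚ) * (n ! : ℚ) * ((m * n)! : ℚ) := by
    have e1 : n - 1 + 1 = n := by omega
    have e2 : m - 1 + 1 = m := by omega
    have h1 : ((m + n - 1)! : ℚ) ≠ 0 := by positivity
    have h2 : ((m * n)! : ℚ) = (m * n : ℚ) * ((m * n - 1)! : ℚ) := by
      rw [← Nat.mul_factorial_pred (Nat.mul_pos hm hn).ne']
      push_cast
      rfl
    rw [h, h2, ShellKmn.g, e1, e2]
    simp only [Nat.add_sub_cancel, Nat.factorial_one, Nat.cast_one, one_mul]
    field_simp
  exact_mod_cast hq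
end

section
/- The number of shellings of the complete graph K_n on n ≥ 2 vertices equals (2^{n-2} / C_{n-1}) · (n choose 2)!, where C_{n-1} = (2n-2 choose n-1)/n is the (n-1)st Catalan number. -/
open SimpleGraph Finset Nat

namespace ShellAux

/-- Lists extending the used set `S`. -/
noncomputable def ext {α : Type*} [DecidableEq α] (E : Finset α) (good : Finset α → Prop) :
    ℕ → Finset α → Finset (List α)
  | 0, _ => {[]}
  | k + 1, S => by
      classical
      exact ((E \ S).filter (fun e => good (insert e S))).biUnion
        (fun e => (ext E good k (insert e S)).image (List.cons e))

theorem card_ext_succ {α : Type*} [DecidableEq α] (E : Finset α) (good : Finset α → Prop)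
    [DecidablePred good] (k : ℕ) (S : Finset α) :
    (ext E good (k + 1) S).card =
      ∑ e ∈ (E \ S).filter (fun e => good (insert e S)), (ext E good k (insert e S)).card := by
  classical
  rw [ext, Finset.card_biUnion]
  · refine Finset.sum_congr (by congr) ?_
    intro e _
    exact Finset.card_image_of_injective _ (List.cons_injective)
  · intro a _ b _ hab
    rw [Function.onFun, Finset.disjoint_left]
    intro l h1 h2
    simp only [Finset.mem_image] at h1 h2
    obtain ⟨l1, _, rfl⟩ := h1
    obtain ⟨l2, _, h⟩ := h2
    exact hab (List.cons.inj h).1.symm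

theorem mem_ext {α : Type*} [DecidableEq α] (E : Finset α) (good : Finset α → Prop)
    (k : ℕ) (S : Finset α) (l : List α) :
    l ∈ ext E good k S ↔ l.length = k ∧ l.Nodup ∧ (∀ e ∈ l, e ∈ E ∧ e ∉ S) ∧
      ∀ i < k, good (S ∪ (l.take (i + 1)).toFinset) := by
  classical
  induction k generalizing S l with
  | zero =>
    simp only [ext, Finset.mem_singleton, List.length_eq_zero_iff]
    constructor
    · rintro rfl; simp
    · exact fun h => h.1
  | succ k ih =>
    rcases l with _ | ⟨a, l⟩
    · simp [ext]
    · have key : a :: l ∈ ext E good (k + 1) S ↔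
          (a ∈ E ∧ a ∉ S) ∧ good (insert a S) ∧ l ∈ ext E good k (insert a S) := by
        simp only [ext, Finset.mem_biUnion, Finset.mem_filter, Finset.mem_sdiff, Finset.mem_image]
        constructor
        · rintro ⟨e, ⟨h1, h2⟩, l', hl', h⟩
          obtain ⟨rfl, rfl⟩ := List.cons.inj h
          exact ⟨h1, h2, hl'⟩
        · rintro ⟨h1, h2, h3⟩
          exact ⟨a, ⟨h1, h2⟩, l, h3, rfl⟩
      have e1 : ∀ T : Finset α, S ∪ insert a T = insert a S ∪ T := by
        intro T; ext x; simp only [Finset.mem_union, Finset.mem_insert]; tauto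
      rw [key, ih]
      constructor
      · rintro ⟨h1, h2, h3, h4, h5, h6⟩
        refine ⟨by simp [h3], ?_, ?_, ?_⟩
        · rw [List.nodup_cons]
          exact ⟨fun h => (h5 a h).2 (Finset.mem_insert_self _ _), h4⟩
        · intro e he
          rcases List.mem_cons.1 he with rfl | he
          · exact h1
          · exact ⟨(h5 e he).1, fun h => (h5 e he).2 (Finset.mem_insert_of_mem h)⟩
        · intro i hi
          rw [List.take_succ_cons, List.toFinset_cons, e1]
          rcases i with _ | i
          · simpa using h2
          · exact h6 i (by omega)
      · rintro ⟨h3, h4, h5, h6⟩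
        rw [List.nodup_cons] at h4
        refine ⟨h5 a (by simp), ?_, by simpa using h3, h4.2, ?_, ?_⟩
        · have := h6 0 (by omega)
          rw [List.take_succ_cons, List.toFinset_cons, e1] at this
          simpa using this
        · intro e he
          refine ⟨(h5 e (by simp [he])).1, ?_⟩
          rw [Finset.mem_insert]
          rintro (rfl | h)
          · exact h4.1 he
          · exact (h5 e (by simp [he])).2 h
        · intro i hi
          have := h6 (i + 1) (by omega)
          rwa [List.take_succ_cons, List.toFinset_cons, e1] at this

/-- goodness of a finite edge set -/
def Good (n : ℕ) (S : Finset (Sym2 (Fin n))) : Prop :=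
  EdgeSetConnected (Fin n) (S : Set (Sym2 (Fin n)))

theorem shellingCount_eq (n : ℕ) :
    shellingCount (⊤ : SimpleGraph (Fin n)) =
      (ext (⊤ : SimpleGraph (Fin n)).edgeFinset (Good n)
        (⊤ : SimpleGraph (Fin n)).edgeFinset.card ∅).card := by
  classical
  set G : SimpleGraph (Fin n) := ⊤ with hG
  have hN : Nat.card G.edgeSet = G.edgeFinset.card := by
    rw [Nat.card_eq_fintype_card, SimpleGraph.edgeFinset_card]
  rw [shellingCount, ← hN, ← Fintype.card_coe, ← Nat.card_eq_fintype_card]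
  have hset : ∀ (σ : Fin (Nat.card G.edgeSet) ≃ G.edgeSet) (k : Fin (Nat.card G.edgeSet)),
      ({e | ∃ i, i ≤ k ∧ (σ i : Sym2 (Fin n)) = e} : Set (Sym2 (Fin n))) =
      (((∅ : Finset (Sym2 (Fin n))) ∪
        ((List.ofFn (fun i => (σ i : Sym2 (Fin n)))).take (k.1 + 1)).toFinset : Finset _) :
          Set (Sym2 (Fin n))) := by
    intro σ k
    ext e
    simp only [Set.mem_setOf_eq, Finset.empty_union, List.coe_toFinset, List.mem_take_iff_getElem,
      List.getElem_ofFn, List.length_ofFn]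
    constructor
    · rintro ⟨i, hi, rfl⟩
      exact ⟨i.1, by have := i.2; have : i.1 ≤ k.1 := hi; omega, rfl⟩
    · rintro ⟨i, hi, rfl⟩
      exact ⟨⟨i, by omega⟩, by rw [Fin.le_def]; simp; omega, rfl⟩
  refine Nat.card_congr (Equiv.ofBijective
    (fun σ => ⟨List.ofFn (fun i => (σ.1 i : Sym2 (Fin n))), ?_⟩) ⟨?_, ?_⟩)
  · rw [mem_ext]
    refine ⟨List.length_ofFn, ?_, ?_, ?_⟩
    · rw [List.nodup_ofFn]
      exact Subtype.val_injective.comp σ.1.injective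
    · intro e he
      rw [List.mem_ofFn] at he
      obtain ⟨i, rfl⟩ := he
      exact ⟨SimpleGraph.mem_edgeFinset.2 (σ.1 i).2, by simp⟩
    · intro i hi
      have := σ.2 ⟨i, hi⟩
      rw [hset] at this
      exact this
  · intro σ τ h
    have h := List.ofFn_injective (Subtype.mk.inj h)
    apply Subtype.ext
    ext i : 1
    exact Subtype.ext (congrFun h i)
  · rintro ⟨l, hl⟩
    have hl' := hl
    rw [mem_ext] at hl
    obtain ⟨h1, h2, h3, h4⟩ := hl
    have hmem : ∀ i : Fin (Nat.card G.edgeSet), l[i.1]'(by rw [h1]; exact i.2) ∈ G.edgeSet :=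
      fun i => SimpleGraph.mem_edgeFinset.1 (h3 _ (List.getElem_mem _)).1
    let f : Fin (Nat.card G.edgeSet) → G.edgeSet := fun i => ⟨_, hmem i⟩
    have hinj : Function.Injective f := by
      intro i j hij
      have := Subtype.mk.inj hij
      rw [h2.getElem_inj_iff] at this
      exact Fin.ext this
    have hbij : Function.Bijective f := by
      rw [Fintype.bijective_iff_injective_and_card]
      exact ⟨hinj, by simp⟩
    have hlist : List.ofFn (fun i => ((Equiv.ofBijective f hbij) i : Sym2 (Fin n))) = l := by
      apply List.ext_getElem
      · simp [h1]
      · intro i _ _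
        rw [List.getElem_ofFn, Equiv.ofBijective_apply]
    refine ⟨⟨Equiv.ofBijective f hbij, ?_⟩, ?_⟩
    · intro k
      rw [hset, hlist]
      exact h4 k.1 k.2
    · exact Subtype.ext hlist

/-- support -/
noncomputable def supp {n : ℕ} (S : Finset (Sym2 (Fin n))) : Finset (Fin n) := by
  classical exact Finset.univ.filter (fun v => ∃ e ∈ S, v ∈ e)

theorem mem_supp {n : ℕ} (S : Finset (Sym2 (Fin n))) (v : Fin n) :
    v ∈ supp S ↔ ∃ e ∈ S, v ∈ e := by
  simp [supp]

theorem induce_support_connected {V : Type*} (G : SimpleGraph V) :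
    (G.induce G.support).Connected ↔
      (∃ v, v ∈ G.support) ∧ ∀ u ∈ G.support, ∀ v ∈ G.support, G.Reachable u v := by
  constructor
  · intro h
    obtain ⟨v⟩ := h.nonempty
    refine ⟨⟨v.1, v.2⟩, ?_⟩
    intro u hu w hw
    exact (h.preconnected ⟨u, hu⟩ ⟨w, hw⟩).map (SimpleGraph.Embedding.induce G.support).toHom
  · rintro ⟨⟨v, hv⟩, h⟩
    have aux : ∀ (u w : V) (p : G.Walk u w) (hu : u ∈ G.support) (hw : w ∈ G.support),
        (G.induce G.support).Reachable ⟨u, hu⟩ ⟨w, hw⟩ := by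
      intro u w p
      induction p with
      | nil => intro _ _; exact SimpleGraph.Reachable.refl _
      | @cons a b c hab p ih =>
        intro hu hw
        have hb : b ∈ G.support := ⟨a, hab.symm⟩
        have hadj : (G.induce G.support).Adj ⟨a, hu⟩ ⟨b, hb⟩ := hab
        exact hadj.reachable.trans (ih hb hw)
    haveI : Nonempty G.support := ⟨⟨v, hv⟩⟩
    refine ⟨?_⟩
    rintro ⟨a, ha⟩ ⟨b, hb⟩
    obtain ⟨p⟩ := h a ha b hb
    exact aux a b p ha hb

theorem support_eq {n : ℕ} (S : Finset (Sym2 (Fin n)))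
    (hS : S ⊆ (⊤ : SimpleGraph (Fin n)).edgeFinset) (v : Fin n) :
    v ∈ (SimpleGraph.fromEdgeSet (S : Set (Sym2 (Fin n)))).support ↔ v ∈ supp S := by
  rw [mem_supp, SimpleGraph.mem_support]
  constructor
  · rintro ⟨w, h⟩
    rw [SimpleGraph.fromEdgeSet_adj] at h
    exact ⟨_, h.1, by simp⟩
  · rintro ⟨e, he, hv⟩
    obtain ⟨w, rfl⟩ := Sym2.mem_iff_exists.1 hv
    refine ⟨w, ?_⟩
    rw [SimpleGraph.fromEdgeSet_adj]
    refine ⟨he, ?_⟩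
    have := hS he
    simpa using this

theorem good_iff {n : ℕ} (S : Finset (Sym2 (Fin n)))
    (hS : S ⊆ (⊤ : SimpleGraph (Fin n)).edgeFinset) :
    Good n S ↔ (supp S).Nonempty ∧ ∀ u ∈ supp S, ∀ v ∈ supp S,
      (SimpleGraph.fromEdgeSet (S : Set (Sym2 (Fin n)))).Reachable u v := by
  rw [Good, EdgeSetConnected, induce_support_connected]
  simp only [support_eq S hS]
  rfl

theorem supp_insert {n : ℕ} (S : Finset (Sym2 (Fin n))) (a b : Fin n) :
    supp (insert s(a, b) S) = insert a (insert b (supp S)) := by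
  ext v
  simp [mem_supp, or_assoc]

theorem good_single {n : ℕ} (a b : Fin n) (hab : a ≠ b) : Good n {s(a, b)} := by
  rw [good_iff _ (by simpa using hab)]
  have hs : supp {s(a, b)} = {a, b} := by
    ext v; simp [mem_supp]
  have hadj : (SimpleGraph.fromEdgeSet
      ((({s(a, b)} : Finset (Sym2 (Fin n)))) : Set (Sym2 (Fin n)))).Adj a b := by
    rw [SimpleGraph.fromEdgeSet_adj]; simp [hab]
  rw [hs]
  refine ⟨by simp, ?_⟩
  intro u hu v hv
  simp only [Finset.mem_insert, Finset.mem_singleton] at hu hv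
  rcases hu with rfl | rfl <;> rcases hv with rfl | rfl
  · exact SimpleGraph.Reachable.refl _
  · exact hadj.reachable
  · exact hadj.symm.reachable
  · exact SimpleGraph.Reachable.refl _

theorem good_insert {n : ℕ} (S : Finset (Sym2 (Fin n)))
    (hS : S ⊆ (⊤ : SimpleGraph (Fin n)).edgeFinset) (hg : Good n S) (a b : Fin n) (hab : a ≠ b) :
    Good n (insert s(a, b) S) ↔ (a ∈ supp S ∨ b ∈ supp S) := by
  have hS' : insert s(a, b) S ⊆ (⊤ : SimpleGraph (Fin n)).edgeFinset := by
    rw [Finset.insert_subset_iff]; exact ⟨by simpa using hab, hS⟩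
  rw [good_iff _ hS'] 
  rw [good_iff _ hS] at hg
  rw [supp_insert]
  set H := SimpleGraph.fromEdgeSet ((insert s(a, b) S : Finset (Sym2 (Fin n))) :
    Set (Sym2 (Fin n))) with hH
  obtain ⟨⟨r, hr⟩, hreach⟩ := hg
  have hadj : H.Adj a b := by
    rw [hH, SimpleGraph.fromEdgeSet_adj]; simp [hab]
  constructor
  · rintro ⟨_, h⟩
    by_contra hcon
    push Not at hcon
    obtain ⟨p⟩ := h a (by simp) r (by simp [hr])
    have aux : ∀ (u w : Fin n) (p : H.Walk u w), (u = a ∨ u = b) → (w = a ∨ w = b) := by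
      intro u w p
      induction p with
      | nil => exact id
      | @cons x y z hxy p ih =>
        intro hx
        apply ih
        rw [hH, SimpleGraph.fromEdgeSet_adj] at hxy
        have h1 := hxy.1
        simp only [Finset.coe_insert, Set.mem_insert_iff, Finset.mem_coe] at h1
        rcases h1 with h1 | h1
        · have : y ∈ s(a, b) := by rw [← h1]; simp
          simpa using this
        · exfalso
          have : x ∈ supp S := (mem_supp S x).2 ⟨_, h1, by simp⟩
          rcases hx with rfl | rfl
          · exact hcon.1 this
          · exact hcon.2 this
    rcases aux a r p (Or.inl rfl) with rfl | rfl
    · exact hcon.1 hr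
    · exact hcon.2 hr
  · intro h
    refine ⟨by simp, ?_⟩
    have mono : ∀ u ∈ supp S, H.Reachable u r := by
      intro u hu
      refine (hreach u hu r hr).mono ?_
      apply SimpleGraph.fromEdgeSet_mono
      simp
    have hab' : H.Reachable a r ∧ H.Reachable b r := by
      rcases h with h | h
      · exact ⟨mono a h, hadj.symm.reachable.trans (mono a h)⟩
      · exact ⟨hadj.reachable.trans (mono b h), mono b h⟩
    have all : ∀ u ∈ insert a (insert b (supp S)), H.Reachable u r := by
      intro u hu
      simp only [Finset.mem_insert] at hu
      rcases hu with rfl | rfl | hu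
      · exact hab'.1
      · exact hab'.2
      · exact mono u hu
    intro u hu v hv
    exact (all u hu).trans (all v hv).symm

/-- the product -/
noncomputable def P (n m : ℕ) : ℚ := ∏ i ∈ Finset.Ico m n, (2 * i : ℚ) / (n + i - 1)

theorem card_E (n : ℕ) : (⊤ : SimpleGraph (Fin n)).edgeFinset.card = n.choose 2 := by
  rw [SimpleGraph.card_edgeFinset_top_eq_card_choose_two, Fintype.card_fin]

theorem P_step (n m k j : ℕ) (hm : m ≤ n) (hm1 : 2 ≤ m) (hN : j + (k + 1) = n.choose 2)
    (c : ℕ) (hc : c + j = m.choose 2) :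
    ((k : ℚ) + 1) * P n m = c * P n m + m * ((n : ℚ) - m) * P n (m + 1) := by
  have hN' : (j : ℚ) + (k + 1) = n * (n - 1) / 2 := by
    rw [← Nat.cast_choose_two, ← hN]; push_cast; ring
  have hc' : (c : ℚ) + j = m * (m - 1) / 2 := by
    rw [← Nat.cast_choose_two, ← hc]; push_cast; ring
  have hk : (k : ℚ) + 1 = c + (n - m) * (n + m - 1) / 2 := by linarith
  rcases hm.eq_or_lt with rfl | hlt
  · rw [hk]; ring
  · have : P n m = (2 * m : ℚ) / (n + m - 1) * P n (m + 1) := by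
      rw [P, P, Finset.prod_eq_prod_Ico_succ_bot hlt]
    have hne : (n : ℚ) + m - 1 ≠ 0 := by
      have h1 : (2 : ℚ) ≤ m := by exact_mod_cast hm1
      have h2 : (m : ℚ) ≤ n := by exact_mod_cast hm
      linarith
    rw [hk, this]
    field_simp

set_option maxHeartbeats 1000000 in
theorem main_count (n : ℕ) (k : ℕ) (S : Finset (Sym2 (Fin n)))
    (hS : S ⊆ (⊤ : SimpleGraph (Fin n)).edgeFinset) (hg : Good n S)
    (hk : S.card + k = n.choose 2) :
    ((ext (⊤ : SimpleGraph (Fin n)).edgeFinset (Good n) k S).card : ℚ) =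
      (k ! : ℚ) * P n (supp S).card := by
  classical
  induction k generalizing S with
  | zero =>
    have hSE : S = (⊤ : SimpleGraph (Fin n)).edgeFinset := by
      apply Finset.eq_of_subset_of_card_le hS
      rw [card_E]; omega
    have hsupp : supp S = Finset.univ := by
      obtain ⟨⟨r, hr⟩, -⟩ := (good_iff S hS).1 hg
      rw [mem_supp] at hr
      obtain ⟨e, he, hre⟩ := hr
      obtain ⟨w, rfl⟩ := Sym2.mem_iff_exists.1 hre
      have hrw : r ≠ w := by have := hS he; simpa using this
      ext v
      simp only [Finset.mem_univ, iff_true]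
      by_cases hv : v = r
      · subst hv; exact (mem_supp S _).2 ⟨_, he, hre⟩
      · refine (mem_supp S _).2 ⟨s(v, r), ?_, by simp⟩
        rw [hSE]; simpa using hv
    simp [ext, hsupp, P]
  | succ k ih =>
    set A := supp S with hA
    have hAn : A.card ≤ n := by simpa using Finset.card_le_univ A
    have hSA : S ⊆ A.offDiag.image Sym2.mk.uncurry := by
      intro e he
      induction e using Sym2.ind with
      | _ a b =>
        have hab : a ≠ b := by have := hS he; simpa using this
        refine Finset.mem_image.2 ⟨(a, b), ?_, rfl⟩
        rw [Finset.mem_offDiag]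
        exact ⟨(mem_supp S _).2 ⟨_, he, by simp⟩, (mem_supp S _).2 ⟨_, he, by simp⟩, hab⟩
    have hA2 : 2 ≤ A.card := by
      obtain ⟨⟨r, hr⟩, -⟩ := (good_iff S hS).1 hg
      rw [mem_supp] at hr
      obtain ⟨e, he, hre⟩ := hr
      obtain ⟨⟨x, y⟩, hx, -⟩ := Finset.mem_image.1 (hSA he)
      rw [Finset.mem_offDiag] at hx
      exact Finset.one_lt_card.2 ⟨x, hx.1, y, hx.2.1, hx.2.2⟩
    have hsplit : ((⊤ : SimpleGraph (Fin n)).edgeFinset \ S).filter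
        (fun e => Good n (insert e S)) =
        (A.offDiag.image Sym2.mk.uncurry \ S) ∪ (A ×ˢ Aᶜ).image Sym2.mk.uncurry := by
      ext e
      induction e using Sym2.ind with
      | _ a b =>
        have hoff : s(a, b) ∈ A.offDiag.image Sym2.mk.uncurry ↔ a ∈ A ∧ b ∈ A ∧ a ≠ b := by
          simp only [Finset.mem_image, Finset.mem_offDiag, Prod.exists, Function.uncurry_apply_pair,
            Sym2.eq_iff]
          constructor
          · rintro ⟨x, y, ⟨h1, h2, h3⟩, ⟨rfl, rfl⟩ | ⟨rfl, rfl⟩⟩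
            · exact ⟨h1, h2, h3⟩
            · exact ⟨h2, h1, h3.symm⟩
          · intro h; exact ⟨a, b, h, Or.inl ⟨rfl, rfl⟩⟩
        have hcr : s(a, b) ∈ (A ×ˢ Aᶜ).image Sym2.mk.uncurry ↔
            (a ∈ A ∧ b ∉ A) ∨ (b ∈ A ∧ a ∉ A) := by
          simp only [Finset.mem_image, Finset.mem_product, Finset.mem_compl, Prod.exists,
            Function.uncurry_apply_pair, Sym2.eq_iff]
          constructor
          · rintro ⟨x, y, ⟨h1, h2⟩, ⟨rfl, rfl⟩ | ⟨rfl, rfl⟩⟩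
            · exact Or.inl ⟨h1, h2⟩
            · exact Or.inr ⟨h1, h2⟩
          · rintro (h | h)
            · exact ⟨a, b, h, Or.inl ⟨rfl, rfl⟩⟩
            · exact ⟨b, a, h, Or.inr ⟨rfl, rfl⟩⟩
        rw [Finset.mem_union, Finset.mem_sdiff, hoff, hcr, Finset.mem_filter, Finset.mem_sdiff]
        have hSm : s(a, b) ∈ S → a ∈ A ∧ b ∈ A := fun h => by
          have := hoff.1 (hSA h); exact ⟨this.1, this.2.1⟩
        have hE : s(a, b) ∈ (⊤ : SimpleGraph (Fin n)).edgeFinset ↔ a ≠ b := by simp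
        rw [hE]
        by_cases hab : a = b
        · subst hab; simp
        · rw [good_insert S hS hg a b hab]
          tauto
    have hdisj : Disjoint (A.offDiag.image Sym2.mk.uncurry \ S)
        ((A ×ˢ Aᶜ).image Sym2.mk.uncurry) := by
      rw [Finset.disjoint_left]
      intro e h1 h2
      simp only [Finset.mem_sdiff, Finset.mem_image, Finset.mem_offDiag, Finset.mem_product,
        Finset.mem_compl, Prod.exists, Function.uncurry_apply_pair] at h1 h2
      obtain ⟨⟨x, y, ⟨hx, hy, -⟩, rfl⟩, -⟩ := h1
      obtain ⟨z, w, ⟨hz, hw⟩, h⟩ := h2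
      rw [Sym2.eq_iff] at h
      rcases h with ⟨rfl, rfl⟩ | ⟨rfl, rfl⟩
      · exact hw hy
      · exact hw hx
    have hc1 : (A.offDiag.image Sym2.mk.uncurry \ S).card + S.card = A.card.choose 2 := by
      rw [Finset.card_sdiff_add_card_eq_card hSA, Sym2.card_image_offDiag]
    have hc2 : ((A ×ˢ Aᶜ).image Sym2.mk.uncurry).card = A.card * (n - A.card) := by
      rw [Finset.card_image_of_injOn, Finset.card_product, Finset.card_compl, Fintype.card_fin]
      rintro ⟨x, y⟩ h1 ⟨z, w⟩ h2 h
      simp only [Finset.coe_product, Set.mem_prod, Finset.mem_coe, Finset.mem_compl] at h1 h2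
      simp only [Function.uncurry_apply_pair, Sym2.eq_iff] at h
      rcases h with ⟨rfl, rfl⟩ | ⟨rfl, rfl⟩
      · rfl
      · exact absurd h1.1 h2.2
    have hgen : ∀ e ∈ ((⊤ : SimpleGraph (Fin n)).edgeFinset \ S).filter
        (fun e => Good n (insert e S)),
        ((ext (⊤ : SimpleGraph (Fin n)).edgeFinset (Good n) k (insert e S)).card : ℚ) =
          (k ! : ℚ) * P n (supp (insert e S)).card := by
      intro e he
      rw [Finset.mem_filter, Finset.mem_sdiff] at he
      refine ih _ ?_ he.2 ?_
      · rw [Finset.insert_subset_iff]; exact ⟨he.1.1, hS⟩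
      · rw [Finset.card_insert_of_notMem he.1.2]; omega
    rw [card_ext_succ, Nat.cast_sum, Finset.sum_congr rfl hgen, hsplit, Finset.sum_union hdisj]
    have hs1 : ∀ e ∈ A.offDiag.image Sym2.mk.uncurry \ S,
        (k ! : ℚ) * P n (supp (insert e S)).card = (k ! : ℚ) * P n A.card := by
      intro e he
      obtain ⟨⟨x, y⟩, hx, rfl⟩ := Finset.mem_image.1 (Finset.mem_sdiff.1 he).1
      rw [Finset.mem_offDiag] at hx
      rw [Function.uncurry_apply_pair, supp_insert, ← hA, Finset.insert_eq_of_mem hx.2.1,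
        Finset.insert_eq_of_mem hx.1]
    have hs2 : ∀ e ∈ (A ×ˢ Aᶜ).image Sym2.mk.uncurry,
        (k ! : ℚ) * P n (supp (insert e S)).card = (k ! : ℚ) * P n (A.card + 1) := by
      intro e he
      obtain ⟨⟨x, y⟩, hx, rfl⟩ := Finset.mem_image.1 he
      rw [Finset.mem_product, Finset.mem_compl] at hx
      rw [Function.uncurry_apply_pair, supp_insert, ← hA,
        Finset.insert_eq_of_mem (Finset.mem_insert_of_mem hx.1), Finset.card_insert_of_notMem hx.2]
    rw [Finset.sum_congr rfl hs1, Finset.sum_congr rfl hs2, Finset.sum_const, Finset.sum_const,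
      hc2, nsmul_eq_mul, nsmul_eq_mul, Nat.factorial_succ]
    have := P_step n A.card k S.card hAn hA2 hk _ hc1
    push_cast [Nat.cast_sub hAn]
    linear_combination (-(k ! : ℚ)) * this

theorem P_two (d : ℕ) : P (d + 2) 2 * (catalan (d + 1) : ℚ) = 2 ^ d := by
  have h1 : P (d + 2) 2 = (2 ^ d * ((d + 1)! : ℚ)) / ((d + 3).ascFactorial d : ℚ) := by
    rw [P, Finset.prod_div_distrib, Finset.prod_Ico_eq_prod_range, Finset.prod_Ico_eq_prod_range]
    congr 1
    · rw [Nat.add_sub_cancel, Finset.prod_mul_distrib, Finset.prod_const, Finset.card_range]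
      congr 1
      induction d with
      | zero => simp
      | succ d ih =>
        rw [Finset.prod_range_succ, ih, Nat.factorial_succ (d + 1)]; push_cast; ring
    · rw [Nat.add_sub_cancel, Nat.ascFactorial_eq_prod_range]
      push_cast
      exact Finset.prod_congr rfl (fun i _ => by ring)
  have h2 : (((d + 2)! : ℕ) : ℚ) * ((d + 3).ascFactorial d : ℚ) = ((2 * (d + 1))! : ℕ) := by
    rw [← Nat.cast_mul, Nat.factorial_mul_ascFactorial]; congr 2; ring
  have h3 : ((d : ℚ) + 2) * catalan (d + 1) = Nat.centralBinom (d + 1) := by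
    have := succ_mul_catalan_eq_centralBinom (d + 1)
    rw [← this]; push_cast; ring
  have h4 : (Nat.centralBinom (d + 1) : ℚ) * ((d + 1)! : ℚ) * ((d + 1)! : ℚ)
      = ((2 * (d + 1))! : ℕ) := by
    have := Nat.choose_mul_factorial_mul_factorial (n := 2 * (d + 1)) (k := d + 1) (by omega)
    rw [show 2 * (d + 1) - (d + 1) = d + 1 by omega] at this
    rw [← this, Nat.centralBinom]; push_cast; ring
  have hpos : ((d + 3).ascFactorial d : ℚ) ≠ 0 := by
    have := Nat.ascFactorial_pos (d + 2) d
    exact_mod_cast this.ne'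
  have hf : ((d + 1)! : ℚ) ≠ 0 := by exact_mod_cast Nat.factorial_ne_zero _
  have hd : (d : ℚ) + 2 ≠ 0 := by positivity
  rw [h1, div_mul_eq_mul_div, div_eq_iff hpos]
  apply mul_left_cancel₀ hd
  apply mul_left_cancel₀ hf
  have h5 : (((d + 2)! : ℕ) : ℚ) = (d + 2) * ((d + 1)! : ℚ) := by
    rw [Nat.factorial_succ (d + 1)]; push_cast; ring
  rw [h5, ← h4] at h2
  linear_combination (2 ^ d * ((d + 1)! : ℚ) * ((d + 1)! : ℚ)) * h3 - 2 ^ d * h2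

end ShellAux

/-- The number of shellings of the complete graph on `n ≥ 2` vertices equals
`2^(n-2) / C_{n-1} * (n choose 2)!`, where `C_{n-1}` is the `(n-1)`-st Catalan
number (stated multiplicatively). -/
theorem shellingCount_completeGraph (n : ℕ) (hn : 2 ≤ n) :
    shellingCount (⊤ : SimpleGraph (Fin n)) * catalan (n - 1) =
      2 ^ (n - 2) * (n.choose 2)! := by
  classical
  obtain ⟨d, rfl⟩ := Nat.exists_eq_add_of_le' hn
  have hpos : 0 < (d + 2).choose 2 := Nat.choose_pos (by omega)
  obtain ⟨k, hk⟩ := Nat.exists_eq_succ_of_ne_zero hpos.ne'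
  have key : (shellingCount (⊤ : SimpleGraph (Fin (d + 2))) : ℚ) =
      (((d + 2).choose 2)! : ℕ) * ShellAux.P (d + 2) 2 := by
    have hgood : ∀ e ∈ (⊤ : SimpleGraph (Fin (d + 2))).edgeFinset,
        ShellAux.Good (d + 2) (insert e ∅) ∧ (ShellAux.supp (insert e ∅)).card = 2 := by
      intro e he
      induction e using Sym2.ind with
      | _ a b =>
        have hab : a ≠ b := by simpa using he
        refine ⟨ShellAux.good_single a b hab, ?_⟩
        rw [ShellAux.supp_insert]
        have : ShellAux.supp (∅ : Finset (Sym2 (Fin (d + 2)))) = ∅ := by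
          ext v; simp [ShellAux.mem_supp]
        rw [this, insert_empty_eq, Finset.card_pair hab]
    rw [ShellAux.shellingCount_eq, ShellAux.card_E, hk, Nat.succ_eq_add_one,
      ShellAux.card_ext_succ, Finset.sdiff_empty,
      Finset.filter_true_of_mem (fun e he => (hgood e he).1), Nat.cast_sum]
    rw [Finset.sum_congr rfl (fun e he => by
      rw [ShellAux.main_count (d + 2) k (insert e ∅) (by simpa using he) (hgood e he).1
        (by rw [insert_empty_eq, Finset.card_singleton, hk]; omega), (hgood e he).2])]
    rw [Finset.sum_const, ShellAux.card_E, hk, nsmul_eq_mul, Nat.factorial_succ]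
    push_cast
    ring
  have h2 := ShellAux.P_two d
  have : ((shellingCount (⊤ : SimpleGraph (Fin (d + 2))) * catalan (d + 1) : ℕ) : ℚ) =
      ((2 ^ d * ((d + 2).choose 2)! : ℕ) : ℚ) := by
    push_cast
    rw [key]
    linear_combination (((d + 2).choose 2)! : ℚ) * h2
  have := Nat.cast_injective this
  simpa using this
end

section
/- Let T be a tree on n vertices and let (u,v) be an edge of T. Then F(T_v)/F(T_u) = |T_u(v)| / (n - |T_u(v)|), where F(T_v) denotes the number of shellings of T rooted at v. -/
open SimpleGraph Finset Nat

section CountLemma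
open Classical in
noncomputable def rkIn {E : Type*} {m : ℕ} (C : Finset E) (σ : Fin m ≃ E) (x : E) : ℕ :=
  (C.filter (fun y => σ.symm y < σ.symm x)).card

theorem rkIn_lt {E : Type*} {m : ℕ} (C : Finset E) (σ : Fin m ≃ E) {x y : E} (hy : y ∈ C)
    (h : σ.symm y < σ.symm x) : rkIn C σ y < rkIn C σ x := by
  classical
  unfold rkIn
  apply Finset.card_lt_card
  rw [Finset.ssubset_iff_of_subset]
  · exact ⟨y, by simp [hy, h], by simp⟩
  · intro z hz
    simp only [Finset.mem_filter] at hz ⊢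
    exact ⟨hz.1, hz.2.trans h⟩

theorem rkIn_lt_iff {E : Type*} {m : ℕ} (C : Finset E) (σ : Fin m ≃ E) {x y : E} (hx : x ∈ C)
    (hy : y ∈ C) : rkIn C σ y < rkIn C σ x ↔ σ.symm y < σ.symm x := by
  refine ⟨fun h => ?_, rkIn_lt C σ hy⟩
  by_contra hn
  rcases lt_or_eq_of_le (not_lt.1 hn) with h1 | h1
  · exact absurd (rkIn_lt C σ hx h1) (by omega)
  · have := σ.symm.injective h1
    subst this
    omega

theorem rkIn_inj {E : Type*} {m : ℕ} (C : Finset E) (σ : Fin m ≃ E) {x y : E} (hx : x ∈ C)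
    (hy : y ∈ C) (h : rkIn C σ x = rkIn C σ y) : x = y := by
  have h1 := rkIn_lt_iff C σ hx hy
  have h2 := rkIn_lt_iff C σ hy hx
  apply σ.symm.injective
  apply le_antisymm
  · rw [← not_lt, ← h1]; omega
  · rw [← not_lt, ← h2]; omega

theorem rkIn_lt_card {E : Type*} {m : ℕ} (C : Finset E) (σ : Fin m ≃ E) {x : E} (hx : x ∈ C) :
    rkIn C σ x < C.card := by
  classical
  unfold rkIn
  apply Finset.card_lt_card
  rw [Finset.ssubset_iff_of_subset (Finset.filter_subset _ _)]
  exact ⟨x, hx, by simp⟩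

theorem rkIn_surj {E : Type*} {m : ℕ} (C : Finset E) (σ : Fin m ≃ E) {j : ℕ} (hj : j < C.card) :
    ∃ x ∈ C, rkIn C σ x = j := by
  have := Finset.surjOn_of_injOn_of_card_le (s := C) (t := Finset.range C.card) (rkIn C σ)
    (fun x hx => by simpa using rkIn_lt_card C σ hx)
    (fun x hx y hy h => rkIn_inj C σ hx hy h) (by simp)
  obtain ⟨x, hx, h⟩ := this (by simpa using hj : j ∈ ((Finset.range C.card : Finset ℕ) : Set ℕ))
  exact ⟨x, hx, h⟩

theorem rkIn_swap {E : Type*} [DecidableEq E] {m : ℕ} (C : Finset E) (σ : Fin m ≃ E) {e x : E}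
    (he : e ∈ C) (hx : x ∈ C) (y : E) :
    rkIn C (σ.trans (Equiv.swap e x)) y = rkIn C σ (Equiv.swap e x y) := by
  classical
  have hC : ∀ z ∈ C, Equiv.swap e x z ∈ C := by
    intro z hz
    rw [Equiv.swap_apply_def]; split_ifs <;> assumption
  unfold rkIn
  apply Finset.card_bij (fun z _ => Equiv.swap e x z)
  · intro z hz
    rw [Finset.mem_filter] at hz ⊢
    simp only [Equiv.symm_trans_apply, Equiv.symm_swap] at hz ⊢
    exact ⟨hC z hz.1, hz.2⟩
  · intro a _ b _ h
    exact (Equiv.swap e x).injective h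
  · intro z hz
    refine ⟨Equiv.swap e x z, ?_, by simp⟩
    rw [Finset.mem_filter] at hz ⊢
    simp only [Equiv.symm_trans_apply, Equiv.symm_swap] at hz ⊢
    exact ⟨hC z hz.1, by simpa using hz.2⟩

open Classical in
theorem count_step {E : Type*} [Fintype E] [DecidableEq E] {m : ℕ} (P : (Fin m ≃ E) → Prop)
    (C : Finset E) (e : E) (he : e ∈ C)
    (hP : ∀ σ x, x ∈ C → x ≠ e →
      (∀ y ∈ C, y ≠ e → y ≠ x → (σ.symm y < σ.symm e ↔ σ.symm y < σ.symm x)) →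
      P σ → P (σ.trans (Equiv.swap e x))) (i j : ℕ) (hj : j < C.card)
    (hij : j = i + 1 ∨ i = j + 1) :
    (Finset.univ.filter (fun σ : Fin m ≃ E => P σ ∧ rkIn C σ e = i)).card ≤
    (Finset.univ.filter (fun σ : Fin m ≃ E => P σ ∧ rkIn C σ e = j)).card := by
  choose nx hnx hnr using fun σ : Fin m ≃ E => rkIn_surj C σ hj
  apply Finset.card_le_card_of_injOn (fun σ => σ.trans (Equiv.swap e (nx σ)))
  · intro σ hσ
    simp only [Finset.coe_filter, Finset.mem_univ, true_and, Set.mem_ofPred_eq] at hσ ⊢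
    refine ⟨hP σ _ (hnx σ) ?_ ?_ hσ.1, ?_⟩
    · intro h
      have := hnr σ
      rw [h] at this
      omega
    · intro y hy h1 h2
      rw [← rkIn_lt_iff C σ he hy, ← rkIn_lt_iff C σ (hnx σ) hy, hnr σ, hσ.2]
      have h3 : rkIn C σ y ≠ i := fun h => h1 (rkIn_inj C σ hy he (h.trans hσ.2.symm))
      have h4 : rkIn C σ y ≠ j := fun h => h2 (rkIn_inj C σ hy (hnx σ) (h.trans (hnr σ).symm))
      omega
    · rw [rkIn_swap C σ he (hnx σ)]
      simpa using hnr σ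
  · intro σ hσ τ hτ h
    simp only [Finset.coe_filter, Finset.mem_univ, true_and, Set.mem_ofPred_eq] at hσ hτ h
    have hx : nx σ = nx τ := by
      apply rkIn_inj C (σ.trans (Equiv.swap e (nx σ))) (hnx σ) (hnx τ)
      conv_rhs => rw [h]
      rw [rkIn_swap C σ he (hnx σ), rkIn_swap C τ he (hnx τ)]
      simp [hσ.2, hτ.2]
    rw [hx] at h
    ext a
    have := congrArg (fun f => f a) h
    simpa using this

open Classical in
theorem count_main {E : Type*} [Fintype E] [DecidableEq E] {m : ℕ} (P : (Fin m ≃ E) → Prop)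
    (C : Finset E) (e : E) (he : e ∈ C)
    (hP : ∀ σ x, x ∈ C → x ≠ e →
      (∀ y ∈ C, y ≠ e → y ≠ x → (σ.symm y < σ.symm e ↔ σ.symm y < σ.symm x)) →
      P σ → P (σ.trans (Equiv.swap e x))) :
    Nat.card {σ : Fin m ≃ E // P σ ∧ ∀ y ∈ C, y ≠ e → σ.symm e < σ.symm y} * C.card =
      Nat.card {σ : Fin m ≃ E // P σ} := by
  set N : ℕ → ℕ := fun i =>
    (Finset.univ.filter (fun σ : Fin m ≃ E => P σ ∧ rkIn C σ e = i)).card with hN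
  have h0 : Nat.card {σ : Fin m ≃ E // P σ ∧ ∀ y ∈ C, y ≠ e → σ.symm e < σ.symm y} = N 0 := by
    rw [Nat.card_eq_fintype_card, Fintype.card_subtype, hN]
    congr 1
    apply Finset.filter_congr
    intro σ _
    apply and_congr_right
    intro _
    unfold rkIn
    rw [Finset.card_eq_zero, Finset.filter_eq_empty_iff]
    constructor
    · intro h y hy
      by_cases hye : y = e
      · subst hye; simp
      · exact not_lt.2 (h y hy hye).le
    · intro h y hy hye
      exact lt_of_le_of_ne (not_lt.1 (h hy)) (fun h => hye (σ.symm.injective h).symm)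
  have hstep : ∀ i, i < C.card → N i = N 0 := by
    intro i
    induction i with
    | zero => intro _; rfl
    | succ k ih =>
      intro hk
      rw [← ih (by omega)]
      exact le_antisymm (count_step P C e he hP _ _ (by omega) (Or.inr rfl))
        (count_step P C e he hP _ _ hk (Or.inl rfl))
  rw [h0, Nat.card_eq_fintype_card, Fintype.card_subtype,
    Finset.card_eq_sum_card_fiberwise (f := fun σ => rkIn C σ e) (t := Finset.range C.card)]
  · rw [Finset.sum_congr rfl (g := fun _ => N 0)]
    · simp [mul_comm]
    · intro i hi
      rw [Finset.filter_filter]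
      exact hstep i (by simpa using hi)
  · intro σ _
    simpa using rkIn_lt_card C σ he
end CountLemma

section GraphPart
variable {V : Type*}

/-- The edge `f` separates the vertex `v` from the edge `g`. -/
def sepE (G : SimpleGraph V) (v : V) (f g : Sym2 V) : Prop :=
  f ≠ g ∧ ∀ x ∈ g, ¬ (G.deleteEdges {f}).Reachable v x

theorem reach_ind {H : SimpleGraph V} {a : V} {Q : V → Prop} (h0 : Q a)
    (hs : ∀ b c, H.Reachable a b → H.Adj b c → Q b → Q c) {b : V} (h : H.Reachable a b) : Q b := by
  rw [SimpleGraph.reachable_iff_reflTransGen] at h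
  induction h with
  | refl => exact h0
  | tail h1 h2 ih =>
    exact hs _ _ ((SimpleGraph.reachable_iff_reflTransGen _ _).2 h1) h2 ih

theorem reach_induce {H : SimpleGraph V} {S : Set V} (hS : ∀ a b, a ∈ S → H.Adj a b → b ∈ S)
    {a b : V} (ha : a ∈ S) (h : H.Reachable a b) :
    ∃ hb : b ∈ S, (H.induce S).Reachable ⟨a, ha⟩ ⟨b, hb⟩ := by
  refine reach_ind (Q := fun b => ∃ hb : b ∈ S, (H.induce S).Reachable ⟨a, ha⟩ ⟨b, hb⟩)
    ⟨ha, SimpleGraph.Reachable.refl _⟩ ?_ h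
  rintro b c _ hbc ⟨hb, hr⟩
  refine ⟨hS b c hb hbc, hr.trans (SimpleGraph.Adj.reachable ?_)⟩
  simpa using hbc

theorem edgeSetConnected_of {S : Set (Sym2 V)} {v : V}
    (hv : v ∈ (SimpleGraph.fromEdgeSet S).support)
    (h : ∀ w ∈ (SimpleGraph.fromEdgeSet S).support, (SimpleGraph.fromEdgeSet S).Reachable v w) :
    EdgeSetConnected V S := by
  unfold EdgeSetConnected
  have hcl : ∀ a b, a ∈ (SimpleGraph.fromEdgeSet S).support →
      (SimpleGraph.fromEdgeSet S).Adj a b → b ∈ (SimpleGraph.fromEdgeSet S).support :=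
    fun a b _ hab => ⟨a, hab.symm⟩
  rw [SimpleGraph.connected_iff_exists_forall_reachable]
  refine ⟨⟨v, hv⟩, ?_⟩
  rintro ⟨w, hw⟩
  exact (reach_induce hcl hv (h w hw)).2

/-- a walk avoiding an edge one of whose ends is not reachable -/
theorem reach_delete {H : SimpleGraph V} {f : Sym2 V} {a b x : V} (hx : x ∈ f)
    (hnx : ¬ H.Reachable a x) (h : H.Reachable a b) : (H.deleteEdges {f}).Reachable a b := by
  refine reach_ind (Q := fun b => (H.deleteEdges {f}).Reachable a b)
    (SimpleGraph.Reachable.refl _) ?_ h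
  intro b c hb hbc hr
  refine hr.trans (SimpleGraph.Adj.reachable ?_)
  rw [SimpleGraph.deleteEdges_adj]
  refine ⟨hbc, ?_⟩
  rintro rfl
  rcases Sym2.mem_iff.1 hx with rfl | rfl
  · exact hnx hb
  · exact hnx (hb.trans hbc.reachable)

/-- some end of `g` is reachable without using `g`. -/
theorem exists_end {G : SimpleGraph V} (hG : G.Connected) (v : V) (g : Sym2 V) :
    ∃ x ∈ g, (G.deleteEdges {g}).Reachable v x := by
  induction g with | h y z =>
  by_contra hn
  push Not at hn
  refine hn y (by simp) ?_
  refine reach_ind (Q := fun b => (G.deleteEdges {s(y, z)}).Reachable v b)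
    (SimpleGraph.Reachable.refl _) ?_ (hG.preconnected v y)
  intro b c _ hbc hr
  refine hr.trans (SimpleGraph.Adj.reachable ?_)
  rw [SimpleGraph.deleteEdges_adj]
  refine ⟨hbc, ?_⟩
  intro h
  refine hn b ?_ hr
  rw [← Set.mem_singleton_iff.1 h]
  simp

/-- A path from `v` to an end of `g` all of whose edges separate `v` from `g`. -/
theorem exists_sep_path {G : SimpleGraph V} (hT : G.IsTree) (v : V) (g : Sym2 V)
    (hg : g ∈ G.edgeSet) : ∃ x ∈ g, ∃ p : G.Walk v x, ∀ f ∈ p.edges, sepE G v f g := by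
  classical
  obtain ⟨x, hx, hr⟩ := exists_end hT.connected v g
  obtain ⟨p0⟩ := hr
  have hp0 : ∀ f ∈ p0.edges, f ≠ g := by
    intro f hf
    have := p0.edges_subset_edgeSet hf
    rw [SimpleGraph.edgeSet_deleteEdges] at this
    exact this.2
  set p1 : G.Walk v x := p0.mapLe (SimpleGraph.deleteEdges_le _) with hp1
  refine ⟨x, hx, p1.bypass, ?_⟩
  intro f hf
  have hfg : f ≠ g := by
    apply hp0
    have := p1.edges_bypass_subset_edges hf
    rw [hp1] at this
    simpa using this
  have key : ¬ (G.deleteEdges {f}).Reachable v x := by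
    rintro ⟨q⟩
    set q1 : G.Walk v x := q.mapLe (SimpleGraph.deleteEdges_le _) with hq1
    have h := hT.isAcyclic.path_unique ⟨p1.bypass, p1.bypass_isPath⟩ ⟨q1.bypass, q1.bypass_isPath⟩
    have h' : p1.bypass = q1.bypass := congrArg Subtype.val h
    rw [h'] at hf
    have := q1.edges_bypass_subset_edges hf
    rw [hq1] at this
    have h2 : f ∈ q.edges := by simpa using this
    have h3 := q.edges_subset_edgeSet h2
    rw [SimpleGraph.edgeSet_deleteEdges] at h3
    exact h3.2 rfl
  refine ⟨hfg, ?_⟩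
  intro y hy hry
  by_cases hxy : y = x
  · subst hxy; exact key hry
  · apply key
    have hgxy : g = s(y, x) := (Sym2.mem_and_mem_iff hxy).1 ⟨hy, hx⟩
    refine hry.trans (SimpleGraph.Adj.reachable ?_)
    rw [SimpleGraph.deleteEdges_adj]
    rw [hgxy] at hg hfg
    exact ⟨by simpa using hg, fun h => hfg h.symm⟩

def LinExt (G : SimpleGraph V) (v : V) (σ : Fin (Nat.card G.edgeSet) ≃ G.edgeSet) : Prop :=
  ∀ f g : G.edgeSet, sepE G v f g → σ.symm f < σ.symm g

theorem shelling_iff [Finite V] {G : SimpleGraph V} (hT : G.IsTree) (v : V)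
    (hm : 0 < Nat.card G.edgeSet) (σ : Fin (Nat.card G.edgeSet) ≃ G.edgeSet) :
    (IsShelling G σ ∧ ∃ h : 0 < Nat.card G.edgeSet, v ∈ (σ ⟨0, h⟩ : Sym2 V)) ↔ LinExt G v σ := by
  have supp : ∀ (S : Set (Sym2 V)), S ⊆ G.edgeSet → ∀ g ∈ S, ∀ x ∈ g,
      x ∈ (SimpleGraph.fromEdgeSet S).support := by
    intro S hS g hg x hx
    obtain ⟨y, rfl⟩ := hx
    refine ⟨y, ?_⟩
    change (SimpleGraph.fromEdgeSet S).Adj x y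
    rw [SimpleGraph.fromEdgeSet_adj]
    exact ⟨hg, SimpleGraph.Adj.ne (by simpa using hS hg)⟩
  constructor
  · rintro ⟨hS, _, hv⟩ f g hfg
    by_contra hlt
    have hlt : σ.symm g < σ.symm f := by
      refine lt_of_le_of_ne (not_lt.1 hlt) ?_
      intro h
      exact hfg.1 (congrArg Subtype.val (σ.symm.injective h)).symm
    have hc := hS (σ.symm g)
    set S : Set (Sym2 V) := {e | ∃ i, i ≤ σ.symm g ∧ (σ i : Sym2 V) = e} with hSdef
    have hSG : S ⊆ G.edgeSet := by
      rintro e ⟨i, _, rfl⟩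
      exact (σ i).2
    have hgS : (g : Sym2 V) ∈ S := ⟨σ.symm g, le_rfl, congrArg Subtype.val (σ.apply_symm_apply g)⟩
    have h0S : (σ ⟨0, hm⟩ : Sym2 V) ∈ S := ⟨⟨0, hm⟩, Nat.zero_le _, rfl⟩
    have hfS : (f : Sym2 V) ∉ S := by
      rintro ⟨i, hi, hif⟩
      have : σ i = f := Subtype.ext hif
      rw [← this, Equiv.symm_apply_apply] at hlt
      exact absurd hi (not_le.2 hlt)
    have hvs := supp S hSG _ h0S v hv
    have hxg : (Quot.out (g : Sym2 V)).1 ∈ (g : Sym2 V) := Sym2.out_fst_mem _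
    have hxs := supp S hSG _ hgS _ hxg
    have hr := hc.preconnected ⟨v, hvs⟩ ⟨_, hxs⟩
    have hr2 := hr.map (SimpleGraph.Embedding.induce _).toHom
    refine hfg.2 _ hxg (SimpleGraph.Reachable.mono ?_ hr2)
    intro a b hab
    rw [SimpleGraph.fromEdgeSet_adj] at hab
    rw [SimpleGraph.deleteEdges_adj]
    refine ⟨by simpa using hSG hab.1, ?_⟩
    intro h
    rw [Set.mem_singleton_iff] at h
    exact hfS (h ▸ hab.1)
  · intro hL
    have hv : v ∈ (σ ⟨0, hm⟩ : Sym2 V) := by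
      obtain ⟨x, hx, p, hp⟩ := exists_sep_path hT v (σ ⟨0, hm⟩ : Sym2 V) (σ ⟨0, hm⟩).2
      cases p with
      | nil => exact hx
      | cons h q =>
        have := hL ⟨_, (G.mem_edgeSet).2 h⟩ (σ ⟨0, hm⟩) (hp _ (by simp))
        rw [Equiv.symm_apply_apply] at this
        exact absurd this (Nat.not_lt_zero _)
    refine ⟨?_, hm, hv⟩
    intro k
    set S : Set (Sym2 V) := {e | ∃ i, i ≤ k ∧ (σ i : Sym2 V) = e} with hSdef
    have hSG : S ⊆ G.edgeSet := by
      rintro e ⟨i, _, rfl⟩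
      exact (σ i).2
    have h0S : (σ ⟨0, hm⟩ : Sym2 V) ∈ S := ⟨⟨0, hm⟩, Nat.zero_le _, rfl⟩
    apply edgeSetConnected_of (supp S hSG _ h0S v hv)
    rintro w ⟨w', hw⟩
    change (SimpleGraph.fromEdgeSet S).Adj w w' at hw
    have hww := hw
    rw [SimpleGraph.fromEdgeSet_adj] at hw
    obtain ⟨i, hik, hi⟩ := hw.1
    obtain ⟨x, hx, p, hp⟩ := exists_sep_path hT v s(w, w') (hSG hw.1)
    have hr : (SimpleGraph.fromEdgeSet S).Reachable v x := by
      refine ⟨p.transfer _ ?_⟩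
      intro f hf
      have hfG := p.edges_subset_edgeSet hf
      rw [SimpleGraph.edgeSet_fromEdgeSet]
      refine ⟨?_, fun h => SimpleGraph.not_isDiag_of_mem_edgeSet _ hfG h⟩
      have := hL ⟨f, hfG⟩ (σ i) (by rw [hi]; exact hp f hf)
      rw [Equiv.symm_apply_apply] at this
      exact ⟨σ.symm ⟨f, hfG⟩, this.le.trans hik, congrArg Subtype.val (σ.apply_symm_apply _)⟩
    rcases Sym2.mem_iff.1 hx with rfl | rfl
    · exact hr
    · exact hr.trans hww.symm.reachable

theorem bridge {G : SimpleGraph V} (hT : G.IsTree) {u v : V} (huv : G.Adj u v) :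
    ¬ (G.deleteEdges {s(u, v)}).Reachable u v :=
  SimpleGraph.isBridge_iff.1 (SimpleGraph.isAcyclic_iff_forall_adj_isBridge.1 hT.isAcyclic huv)

theorem reach_or {G : SimpleGraph V} (hT : G.IsTree) {u v : V} (w : V) :
    (G.deleteEdges {s(u, v)}).Reachable u w ∨ (G.deleteEdges {s(u, v)}).Reachable v w := by
  refine reach_ind (Q := fun w => (G.deleteEdges {s(u, v)}).Reachable u w ∨
    (G.deleteEdges {s(u, v)}).Reachable v w)
    (Or.inl (SimpleGraph.Reachable.refl _)) ?_ (hT.connected.preconnected u w)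
  intro b c _ hbc hr
  by_cases h : s(b, c) = s(u, v)
  · have hc : c ∈ s(u, v) := by rw [← h]; simp
    rcases Sym2.mem_iff.1 hc with rfl | rfl
    · exact Or.inl (SimpleGraph.Reachable.refl _)
    · exact Or.inr (SimpleGraph.Reachable.refl _)
  · have : (G.deleteEdges {s(u, v)}).Adj b c := by
      rw [SimpleGraph.deleteEdges_adj]; exact ⟨hbc, h⟩
    exact hr.imp (fun h => h.trans this.reachable) (fun h => h.trans this.reachable)

theorem reach_not {G : SimpleGraph V} (hT : G.IsTree) {u v : V} (huv : G.Adj u v) (w : V) :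
    (G.deleteEdges {s(u, v)}).Reachable v w ↔ ¬ (G.deleteEdges {s(u, v)}).Reachable u w :=
  ⟨fun h h' => bridge hT huv (h'.trans h.symm), fun h => (reach_or hT w).resolve_left h⟩

theorem subtreeSize_eq {G : SimpleGraph V} (hT : G.IsTree) {u v : V} (huv : G.Adj u v) :
    subtreeSize G u v = Nat.card {w : V | (G.deleteEdges {s(u, v)}).Reachable v w} := by
  classical
  unfold subtreeSize
  have : {w : V | ∀ p : G.Path u w, v ∈ (p : G.Walk u w).support} =
      {w : V | (G.deleteEdges {s(u, v)}).Reachable v w} := by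
    ext w
    change (∀ p : G.Path u w, v ∈ (p : G.Walk u w).support) ↔
      (G.deleteEdges {s(u, v)}).Reachable v w
    rw [reach_not hT huv]
    constructor
    · rintro h ⟨p⟩
      have h1 := h ((p.mapLe (SimpleGraph.deleteEdges_le _)).toPath)
      have h2 := SimpleGraph.Walk.support_bypass_subset_support _ h1
      have h3 : v ∈ p.support := by simpa using h2
      exact bridge hT huv ⟨p.takeUntil v h3⟩
    · intro h p
      by_contra hn
      apply h
      refine ⟨(p : G.Walk u w).transfer _ ?_⟩
      intro f hf
      rw [SimpleGraph.edgeSet_deleteEdges]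
      refine ⟨SimpleGraph.Walk.edges_subset_edgeSet _ hf, ?_⟩
      rintro rfl
      exact hn (SimpleGraph.Walk.snd_mem_support_of_mem_edges _ hf)
  rw [this]

open Classical in
/-- `e = uv` together with the edges separated by it from `v`. -/
noncomputable def sideC [Fintype V] (G : SimpleGraph V) (v : V) (e : Sym2 V) : Finset G.edgeSet :=
  Finset.univ.filter (fun g : G.edgeSet => (g : Sym2 V) = e ∨ sepE G v e g)

theorem sideC_card_ge [Fintype V] {G : SimpleGraph V} (hT : G.IsTree) {u v : V}
    (huv : G.Adj u v) :
    Nat.card {w : V | (G.deleteEdges {s(u, v)}).Reachable v w} ≤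
      (sideC G u s(u, v)).card := by
  classical
  set H := G.deleteEdges {s(u, v)} with hH
  set B : Set V := {w : V | H.Reachable v w} with hB
  have hvB : v ∈ B := SimpleGraph.Reachable.refl _
  have hcon : (H.induce B).Connected := by
    rw [SimpleGraph.connected_iff_exists_forall_reachable]
    refine ⟨⟨v, hvB⟩, ?_⟩
    rintro ⟨w, hw⟩
    exact (reach_induce (fun a b (ha : H.Reachable v a) hab => ha.trans hab.reachable) hvB hw).2
  refine hcon.card_vert_le_card_edgeSet_add_one.trans ?_
  have hmem : ∀ g : (H.induce B).edgeSet, Sym2.map Subtype.val (g : Sym2 B) ∈ H.edgeSet := by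
    rintro ⟨g, hg⟩
    induction g with | h a b =>
    simpa using hg
  have hmemG : ∀ g : (H.induce B).edgeSet, Sym2.map Subtype.val (g : Sym2 B) ∈ G.edgeSet ∧
      Sym2.map Subtype.val (g : Sym2 B) ≠ s(u, v) := by
    intro g
    have := hmem g
    have h2 : H.edgeSet = G.edgeSet \ {s(u, v)} := SimpleGraph.edgeSet_deleteEdges _
    rw [h2] at this
    exact this
  have hle : Nat.card (H.induce B).edgeSet ≤
      ((sideC G u s(u, v)).erase ⟨s(u, v), (G.mem_edgeSet).2 huv⟩).card := by
    rw [Nat.card_eq_fintype_card, ← Finset.card_univ]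
    apply Finset.card_le_card_of_injOn (fun g => ⟨Sym2.map Subtype.val (g : Sym2 B), (hmemG g).1⟩)
    · intro g _
      simp only [Finset.coe_erase, sideC]
      refine ⟨?_, fun h => (hmemG g).2 (congrArg Subtype.val h)⟩
      simp only [Finset.coe_filter, Finset.mem_univ, true_and]
      refine Or.inr ⟨(hmemG g).2.symm, ?_⟩
      intro x hx
      rw [← reach_not hT huv]
      obtain ⟨y, hy, rfl⟩ := Sym2.mem_map.1 hx
      exact y.2
    · intro g _ g' _ h
      have := congrArg Subtype.val h
      exact Subtype.ext (Sym2.map.injective Subtype.val_injective this)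
  rw [Finset.card_erase_of_mem (by simp [sideC])] at hle
  have : 0 < (sideC G u s(u, v)).card :=
    Finset.card_pos.2 ⟨⟨s(u, v), (G.mem_edgeSet).2 huv⟩, by simp [sideC]⟩
  omega

/-- The condition on orderings that ignores `e`. -/
def Pe (G : SimpleGraph V) (v : V) (e : Sym2 V)
    (σ : Fin (Nat.card G.edgeSet) ≃ G.edgeSet) : Prop :=
  ∀ f g : G.edgeSet, (f : Sym2 V) ≠ e → (g : Sym2 V) ≠ e → sepE G v f g → σ.symm f < σ.symm g

theorem sepE_swap {G : SimpleGraph V} {u v : V} (huv : G.Adj u v) {f g : Sym2 V}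
    (hf : f ≠ s(u, v)) (h : sepE G u f g) : sepE G v f g := by
  refine ⟨h.1, fun x hx hr => h.2 x hx (SimpleGraph.Reachable.trans ?_ hr)⟩
  apply SimpleGraph.Adj.reachable
  rw [SimpleGraph.deleteEdges_adj]
  exact ⟨huv, fun h => hf h.symm⟩

theorem Pe_comm {G : SimpleGraph V} {u v : V} (huv : G.Adj u v)
    (σ : Fin (Nat.card G.edgeSet) ≃ G.edgeSet) : Pe G u s(u, v) σ ↔ Pe G v s(u, v) σ := by
  constructor
  · intro h f g hf hg hs
    exact h f g hf hg (sepE_swap huv.symm (by rwa [Sym2.eq_swap]) hs)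
  · intro h f g hf hg hs
    exact h f g hf hg (sepE_swap huv hf hs)

theorem linExt_iff [Fintype V] {G : SimpleGraph V} {u v : V} (huv : G.Adj u v)
    (σ : Fin (Nat.card G.edgeSet) ≃ G.edgeSet) :
    LinExt G u σ ↔ (Pe G u s(u, v) σ ∧ ∀ y ∈ sideC G u s(u, v), y ≠ ⟨s(u, v), (G.mem_edgeSet).2 huv⟩ →
      σ.symm ⟨s(u, v), (G.mem_edgeSet).2 huv⟩ < σ.symm y) := by
  constructor
  · intro h
    refine ⟨fun f g _ _ hs => h f g hs, ?_⟩
    intro y hy hne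
    simp only [sideC, Finset.mem_filter, Finset.mem_univ, true_and] at hy
    rcases hy with hy | hy
    · exact absurd (Subtype.ext hy) hne
    · exact h _ _ hy
  · rintro ⟨h1, h2⟩ f g hs
    by_cases hg : (g : Sym2 V) = s(u, v)
    · exact absurd (SimpleGraph.Reachable.refl u) (hs.2 u (by rw [hg]; simp))
    by_cases hf : (f : Sym2 V) = s(u, v)
    · have hf' : f = ⟨s(u, v), (G.mem_edgeSet).2 huv⟩ := Subtype.ext hf
      rw [hf']
      apply h2
      · simp only [sideC, Finset.mem_filter, Finset.mem_univ, true_and]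
        right; rw [← hf]; exact hs
      · intro h; exact hg (congrArg Subtype.val h)
    · exact h1 f g hf hg hs

/-- Each edge other than `uv` lies on one of the two sides. -/
theorem side_total {G : SimpleGraph V} (hT : G.IsTree) {u v : V} (huv : G.Adj u v) {g : Sym2 V}
    (hg : g ∈ G.edgeSet) (hne : g ≠ s(u, v)) :
    (∀ x ∈ g, (G.deleteEdges {s(u, v)}).Reachable u x) ∨
    (∀ x ∈ g, (G.deleteEdges {s(u, v)}).Reachable v x) := by
  induction g with | h a b =>
  have hab : (G.deleteEdges {s(u, v)}).Adj a b := by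
    rw [SimpleGraph.deleteEdges_adj]; exact ⟨hg, hne⟩
  rcases reach_or hT (u := u) (v := v) a with h | h
  · left; intro x hx
    rcases Sym2.mem_iff.1 hx with rfl | rfl
    · exact h
    · exact h.trans hab.reachable
  · right; intro x hx
    rcases Sym2.mem_iff.1 hx with rfl | rfl
    · exact h
    · exact h.trans hab.reachable

theorem sepE_uv_iff {G : SimpleGraph V} (hT : G.IsTree) {u v : V} (huv : G.Adj u v) {g : Sym2 V}
    (hne : g ≠ s(u, v)) :
    sepE G u s(u, v) g ↔ ∀ x ∈ g, (G.deleteEdges {s(u, v)}).Reachable v x := by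
  simp only [sepE, reach_not hT huv]
  exact ⟨fun h => h.2, fun h => ⟨hne.symm, h⟩⟩

/-- Comparable edges lie on the same side. -/
theorem same_side {G : SimpleGraph V} (hT : G.IsTree) {u v : V} (huv : G.Adj u v) {f g : Sym2 V}
    (hfG : f ∈ G.edgeSet) (hgG : g ∈ G.edgeSet)
    (hf : f ≠ s(u, v)) (hg : g ≠ s(u, v)) (hs : sepE G u f g) :
    sepE G u s(u, v) f ↔ sepE G u s(u, v) g := by
  have hle : (G.deleteEdges {s(u, v)}).deleteEdges {f} ≤ G.deleteEdges {f} := by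
    intro a b h
    simp only [SimpleGraph.deleteEdges_adj] at h ⊢
    exact ⟨h.1.1, h.2⟩
  have hxg := Sym2.out_fst_mem g
  have hxf := Sym2.out_fst_mem f
  rw [sepE_uv_iff hT huv hf, sepE_uv_iff hT huv hg]
  constructor
  · intro h
    refine (side_total hT huv hgG hg).resolve_left ?_
    intro h'
    refine hs.2 _ hxg (SimpleGraph.Reachable.mono hle (reach_delete hxf ?_ (h' _ hxg)))
    rw [← reach_not hT huv]
    exact h _ hxf
  · intro h
    refine (side_total hT huv hfG hf).resolve_left ?_
    intro h'
    refine (sepE_swap huv hf hs).2 _ hxg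
      (SimpleGraph.Reachable.mono hle (reach_delete hxf ?_ (h _ hxg)))
    rw [reach_not hT huv, not_not]
    exact h' _ hxf

theorem count_side [Fintype V] {G : SimpleGraph V} (hT : G.IsTree) {u v : V} (huv : G.Adj u v) :
    rootedShellingCount G u * (sideC G u s(u, v)).card =
      Nat.card {σ : Fin (Nat.card G.edgeSet) ≃ G.edgeSet // Pe G u s(u, v) σ} := by
  classical
  have hm : 0 < Nat.card G.edgeSet := by
    have : Nonempty (G.edgeSet) := ⟨⟨s(u, v), (G.mem_edgeSet).2 huv⟩⟩
    exact Nat.card_pos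
  rw [← count_main (Pe G u s(u, v)) (sideC G u s(u, v)) ⟨s(u, v), (G.mem_edgeSet).2 huv⟩ (by simp [sideC])]
  · unfold rootedShellingCount
    congr 1
    apply Nat.card_congr
    apply Equiv.subtypeEquivRight
    intro σ
    rw [shelling_iff hT u hm, linExt_iff huv]
  · intro σ x hx hxe hadj hP f g hf hg hs
    have hfe : f ≠ ⟨s(u, v), (G.mem_edgeSet).2 huv⟩ := fun h => hf (congrArg Subtype.val h)
    have hge : g ≠ ⟨s(u, v), (G.mem_edgeSet).2 huv⟩ := fun h => hg (congrArg Subtype.val h)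
    have hfg : f ≠ g := fun h => hs.1 (congrArg Subtype.val h)
    have hlt := hP f g hf hg hs
    have hss := same_side hT huv f.2 g.2 hf hg hs
    have hmC : ∀ y : G.edgeSet, (y : Sym2 V) ≠ s(u, v) →
        (y ∈ sideC G u s(u, v) ↔ sepE G u s(u, v) y) := by
      intro y hy
      simp [sideC, hy]
    rw [← hmC f hf, ← hmC g hg] at hss
    simp only [Equiv.symm_trans_apply, Equiv.symm_swap]
    by_cases hfx : f = x
    · subst hfx
      rw [Equiv.swap_apply_right, Equiv.swap_apply_of_ne_of_ne hge hfg.symm]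
      have h1 := hadj g (hss.1 hx) hge hfg.symm
      have h2 : σ.symm g ≠ σ.symm ⟨s(u, v), (G.mem_edgeSet).2 huv⟩ := fun h => hge (σ.symm.injective h)
      have h3 : ¬ σ.symm g < σ.symm ⟨s(u, v), (G.mem_edgeSet).2 huv⟩ := fun h => absurd (h1.1 h) hlt.le.not_gt
      exact lt_of_le_of_ne (not_lt.1 h3) h2.symm
    · by_cases hgx : g = x
      · subst hgx
        rw [Equiv.swap_apply_right, Equiv.swap_apply_of_ne_of_ne hfe hfg]
        exact (hadj f (hss.2 hx) hfe hfg).2 hlt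
      · rw [Equiv.swap_apply_of_ne_of_ne hfe hfx, Equiv.swap_apply_of_ne_of_ne hge hgx]
        exact hlt

theorem sideC_inter [Fintype V] {G : SimpleGraph V} (hT : G.IsTree) {u v : V} (huv : G.Adj u v) :
    (sideC G u s(u, v)).card + (sideC G v s(u, v)).card ≤ Fintype.card V := by
  classical
  have hE : Nat.card G.edgeSet + 1 = Fintype.card V := by
    rw [← hT.card_edgeFinset, Nat.card_eq_fintype_card, SimpleGraph.edgeFinset_card]
  rw [← Finset.card_union_add_card_inter, ← hE]
  have h1 : (sideC G u s(u, v) ∪ sideC G v s(u, v)).card ≤ Nat.card G.edgeSet := by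
    rw [Nat.card_eq_fintype_card]; exact Finset.card_le_univ _
  have h2 : (sideC G u s(u, v) ∩ sideC G v s(u, v)).card ≤ 1 := by
    have : Nonempty (G.edgeSet) := ⟨⟨s(u, v), (G.mem_edgeSet).2 huv⟩⟩
    refine Finset.card_le_one_iff_subset_singleton.2 ⟨⟨s(u, v), (G.mem_edgeSet).2 huv⟩, ?_⟩
    intro g hg
    simp only [sideC, Finset.mem_inter, Finset.mem_filter, Finset.mem_univ, true_and] at hg
    rw [Finset.mem_singleton]
    apply Subtype.ext
    by_contra hne
    have h3 := (hg.1.resolve_left hne).2 _ (Sym2.out_fst_mem (g : Sym2 V))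
    have h4 := (hg.2.resolve_left hne).2 _ (Sym2.out_fst_mem (g : Sym2 V))
    exact (reach_or hT _).elim h3 h4
  omega

end GraphPart

/-- For an edge `(u,v)` of a tree `T` on `n` vertices,
`F(T_v)/F(T_u) = |T_u(v)|/(n - |T_u(v)|)` (stated multiplicatively). -/
theorem rootedShellingCount_ratio {V : Type*} [Fintype V] (G : SimpleGraph V)
    (hT : G.IsTree) (u v : V) (huv : G.Adj u v) :
    rootedShellingCount G v * (Fintype.card V - subtreeSize G u v) =
      rootedShellingCount G u * subtreeSize G u v := by
  classical
  have hsw : s(v, u) = s(u, v) := Sym2.eq_swap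
  have hb := sideC_card_ge hT huv
  have ha := sideC_card_ge hT huv.symm
  rw [hsw] at ha
  have hab := sideC_inter hT huv
  have hsum : Nat.card {w : V | (G.deleteEdges {s(u, v)}).Reachable v w} +
      Nat.card {w : V | (G.deleteEdges {s(u, v)}).Reachable u w} = Fintype.card V := by
    have hc : {w : V | (G.deleteEdges {s(u, v)}).Reachable v w} =
        {w : V | (G.deleteEdges {s(u, v)}).Reachable u w}ᶜ := by
      ext w
      exact reach_not hT huv w
    rw [hc, add_comm, ← Nat.card_eq_fintype_card]
    exact Set.ncard_add_ncard_compl _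
  have hs := subtreeSize_eq hT huv
  have e1 : subtreeSize G u v = (sideC G u s(u, v)).card := by omega
  have e2 : Fintype.card V - subtreeSize G u v = (sideC G v s(u, v)).card := by omega
  rw [e2, e1, count_side hT huv]
  have := count_side hT huv.symm
  rw [hsw] at this
  rw [this]
  exact Nat.card_congr (Equiv.subtypeEquivRight (fun σ => (Pe_comm huv σ).symm))
end

section
/- For any tree T on n ≥ 2 vertices, the number of shellings F(T) satisfies F(T) ≥ ∏_{v ∈ V(T)} d(v)!, where d(v) is the degree of v. Equality holds if and only if T is a path or a star. -/
open SimpleGraph Finset Nat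

namespace Shell
variable {V : Type*}

/-- valid edge orders -/
def Orders (S : Finset (Sym2 V)) : Set (List (Sym2 V)) :=
  {l | l.Nodup ∧ (∀ e, e ∈ l ↔ e ∈ S) ∧
    ∀ k, k < l.length → EdgeSetConnected V {e | e ∈ l.take (k+1)}}

noncomputable def cnt (S : Finset (Sym2 V)) : ℕ := (Orders S).ncard

lemma Orders_length {S : Finset (Sym2 V)} {l} (h : l ∈ Orders S) : l.length = #S := by
  classical
  rw [← List.toFinset_card_of_nodup h.1]
  congr 1
  ext e; simp [h.2.1]

lemma Orders_finite [Finite V] (S : Finset (Sym2 V)) : (Orders S).Finite :=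
  (List.finite_length_eq (Sym2 V) (#S)).subset fun _ h => Orders_length h

lemma shellingCount_eq [Fintype V] (G : SimpleGraph V) (S : Finset (Sym2 V))
    (hS : ∀ e, e ∈ S ↔ e ∈ G.edgeSet) : shellingCount G = cnt S := by
  classical
  have hc : Nat.card G.edgeSet = #S := by
    rw [Nat.card_coe_set_eq, ← Set.ncard_coe_finset]
    congr 1; ext e; simp [hS]
  unfold shellingCount cnt
  rw [← Nat.card_coe_set_eq]
  have key : ∀ (σ : Fin (Nat.card G.edgeSet) ≃ G.edgeSet) (k : Fin (Nat.card G.edgeSet)),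
      {e | ∃ i, i ≤ k ∧ (σ i : Sym2 V) = e} =
      {e | e ∈ (List.ofFn (fun i => (σ i : Sym2 V))).take (k+1)} := by
    intro σ k
    ext e
    simp only [Set.mem_ofPred_eq, List.mem_take_iff_getElem, List.length_ofFn, List.getElem_ofFn]
    constructor
    · rintro ⟨i, hi, rfl⟩
      exact ⟨i, by have := i.2; have : i.1 ≤ k.1 := hi; omega, rfl⟩
    · rintro ⟨i, hi, rfl⟩
      exact ⟨⟨i, by omega⟩, by show i ≤ k.1; omega, rfl⟩
  have mem : ∀ σ : Fin (Nat.card G.edgeSet) ≃ G.edgeSet, IsShelling G σ →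
      List.ofFn (fun i => (σ i : Sym2 V)) ∈ Orders S := by
    intro σ h
    refine ⟨?_, ?_, ?_⟩
    · rw [List.nodup_ofFn]
      exact Subtype.val_injective.comp σ.injective
    · intro e
      rw [List.mem_ofFn, hS]
      constructor
      · rintro ⟨i, rfl⟩; exact (σ i).2
      · intro he; exact ⟨σ.symm ⟨e, he⟩, congrArg Subtype.val (σ.apply_symm_apply ⟨e, he⟩)⟩
    · intro k hk
      rw [List.length_ofFn] at hk
      have := h ⟨k, hk⟩
      rwa [key] at this
  refine Nat.card_congr (Equiv.ofBijective (fun σ => ⟨_, mem σ.1 σ.2⟩) ⟨?_, ?_⟩)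
  · rintro ⟨σ, h⟩ ⟨τ, h'⟩ heq
    simp only [Subtype.mk.injEq] at heq
    have := List.ofFn_injective heq
    apply Subtype.ext
    apply Equiv.ext
    intro i
    exact Subtype.ext (congrArg (fun f => f i) this)
  · rintro ⟨l, hl⟩
    have hlen : Nat.card G.edgeSet = l.length := by rw [hc, Orders_length hl]
    let f : Fin (Nat.card G.edgeSet) → G.edgeSet :=
      fun i => ⟨l[i.1]'(hlen ▸ i.2), (hS _).1 ((hl.2.1 _).1 (List.getElem_mem _))⟩
    have hf : Function.Bijective f := by
      constructor
      · intro i j hij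
        have := congrArg Subtype.val hij
        simp only [f] at this
        rw [List.Nodup.getElem_inj_iff hl.1] at this
        exact Fin.ext this
      · rintro ⟨e, he⟩
        have := (hl.2.1 e).2 ((hS e).2 he)
        obtain ⟨i, hi, rfl⟩ := List.getElem_of_mem this
        exact ⟨⟨i, hlen ▸ hi⟩, rfl⟩
    have hof : List.ofFn (fun i => ((Equiv.ofBijective f hf) i : Sym2 V)) = l := by
      apply List.ext_getElem
      · rw [List.length_ofFn, hlen]
      · intro i h1 h2
        rw [List.getElem_ofFn]
        rfl
    refine ⟨⟨Equiv.ofBijective f hf, ?_⟩, Subtype.ext hof⟩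
    intro k
    rw [key, hof]
    exact hl.2.2 k (hlen ▸ k.2)

lemma cnt_empty : cnt (∅ : Finset (Sym2 V)) = 1 := by
  have : Orders (∅ : Finset (Sym2 V)) = {[]} := by
    ext l
    constructor
    · intro h
      exact List.length_eq_zero_iff.1 (by simpa using Orders_length h)
    · rintro rfl
      exact ⟨by simp, by simp, by simp⟩
  rw [cnt, this, Set.ncard_singleton]

lemma cnt_eq_zero {S : Finset (Sym2 V)} (hne : S.Nonempty) (h : ¬ EdgeSetConnected V S) :
    cnt S = 0 := by
  have : Orders S = ∅ := by
    rw [Set.eq_empty_iff_forall_notMem]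
    intro l hl
    have hlen := Orders_length hl
    have hpos := hne.card_pos
    have := hl.2.2 (l.length - 1) (by omega)
    rw [Nat.sub_add_cancel (by omega), List.take_length] at this
    apply h
    convert this using 1
    ext e; simp [hl.2.1]
  rw [cnt, this, Set.ncard_empty]

lemma cnt_rec [Finite V] [DecidableEq (Sym2 V)] {S : Finset (Sym2 V)} (hne : S.Nonempty)
    (h : EdgeSetConnected V S) : cnt S = ∑ e ∈ S, cnt (S.erase e) := by
  have hU : Orders S = ⋃ e ∈ S, Set.image (fun l => l ++ [e]) (Orders (S.erase e)) := by
    ext l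
    simp only [Set.mem_iUnion, Set.mem_image]
    constructor
    · intro hl
      have hlen := Orders_length hl
      have hpos := hne.card_pos
      rcases List.eq_nil_or_concat l with rfl | ⟨l', e, rfl⟩
      · simp at hlen; omega
      · simp only [List.concat_eq_append] at hl ⊢
        refine ⟨e, (hl.2.1 e).1 (by simp), l', ?_, rfl⟩
        have hnd := hl.1
        rw [List.nodup_append] at hnd
        have hel : e ∉ l' := fun h' => hnd.2.2 e h' e (by simp) rfl
        refine ⟨hnd.1, ?_, ?_⟩
        · intro e'
          rw [Finset.mem_erase, ← hl.2.1]
          simp only [List.mem_append, List.mem_singleton]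
          constructor
          · intro h'; exact ⟨fun h2 => hel (h2 ▸ h'), Or.inl h'⟩
          · rintro ⟨h1, h2 | h2⟩
            · exact h2
            · exact absurd h2 h1
        · intro k hk
          have := hl.2.2 k (by simp; omega)
          rwa [List.take_append_of_le_length (by omega)] at this
    · rintro ⟨e, he, l', hl', rfl⟩
      have hel : e ∉ l' := fun h' => by simpa using (hl'.2.1 e).1 h'
      have hm : ∀ e', e' ∈ l' ++ [e] ↔ e' ∈ S := by
        intro e'
        simp only [List.mem_append, List.mem_singleton, hl'.2.1, Finset.mem_erase]
        by_cases h' : e' = e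
        · simp [h', he]
        · simp [h']
      refine ⟨?_, hm, ?_⟩
      · rw [List.nodup_append]
        refine ⟨hl'.1, by simp, ?_⟩
        intro a ha b hb hab
        simp at hb
        exact hel (by rw [← hb, ← hab]; exact ha)
      · intro k hk
        simp at hk
        rcases Nat.lt_or_ge k l'.length with h1 | h1
        · rw [List.take_append_of_le_length (by omega)]
          exact hl'.2.2 k h1
        · rw [List.take_of_length_le (by simp; omega)]
          convert h using 1
          ext e'; simpa using hm e'
  rw [cnt, hU]
  have : (⋃ e ∈ S, Set.image (fun l => l ++ [e]) (Orders (S.erase e))) =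
      ⋃ e ∈ (S : Set (Sym2 V)), Set.image (fun l => l ++ [e]) (Orders (S.erase e)) := by simp
  rw [this, S.finite_toSet.ncard_biUnion (fun e _ => (Orders_finite _).image _),
    finsum_mem_coe_finset]
  · refine Finset.sum_congr rfl fun e _ => ?_
    rw [cnt, Set.ncard_image_of_injective]
    intro a b hab
    simpa using hab
  · intro a _ b _ hab
    rw [Function.onFun, Set.disjoint_left]
    rintro _ ⟨l, _, rfl⟩ ⟨l', _, h'⟩
    simp only at h'
    exact hab (List.append_singleton_inj.1 h').2.symm

end Shell

namespace Shell
variable {V : Type*} [Fintype V] [DecidableEq V]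

/-- degree of a vertex in an edge set -/
def dg (S : Finset (Sym2 V)) (v : V) : ℕ := #{e ∈ S | v ∈ e}

structure TS (S : Finset (Sym2 V)) : Prop where
  nd : ∀ e ∈ S, ¬ e.IsDiag
  conn : EdgeSetConnected V S
  card : (SimpleGraph.fromEdgeSet (S : Set (Sym2 V))).support.ncard = #S + 1

lemma mem_supp {S : Finset (Sym2 V)} (nd : ∀ e ∈ S, ¬ e.IsDiag) (v : V) :
    v ∈ (SimpleGraph.fromEdgeSet (S : Set (Sym2 V))).support ↔ ∃ e ∈ S, v ∈ e := by
  rw [SimpleGraph.mem_support]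
  constructor
  · rintro ⟨w, hw⟩
    rw [SimpleGraph.fromEdgeSet_adj] at hw
    exact ⟨_, hw.1, by simp⟩
  · rintro ⟨e, he, hv⟩
    obtain ⟨w, rfl⟩ := hv
    exact ⟨w, by
      rw [SimpleGraph.fromEdgeSet_adj]
      exact ⟨he, fun h => nd _ he (by simpa using h)⟩⟩

lemma dg_pos {S : Finset (Sym2 V)} (v : V) : 0 < dg S v ↔ ∃ e ∈ S, v ∈ e := by
  rw [dg, Finset.card_pos]
  constructor
  · rintro ⟨e, he⟩
    simp at he
    exact ⟨e, he⟩
  · rintro ⟨e, he⟩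
    exact ⟨e, by simpa using he⟩

lemma leaf_unique {S : Finset (Sym2 V)} {v : V} (h : dg S v = 1) {e e' : Sym2 V}
    (he : e ∈ S) (hv : v ∈ e) (he' : e' ∈ S) (hv' : v ∈ e') : e' = e :=
  Finset.card_le_one.1 h.le _ (by simp [he', hv']) _ (by simp [he, hv])

lemma supp_erase_leaf {S : Finset (Sym2 V)} (h : TS S) {l : V} (hl : dg S l = 1)
    {e : Sym2 V} (he : e ∈ S) (hle : l ∈ e) (h2 : 2 ≤ #S) :
    TS (S.erase e) := by
  have nd' : ∀ e' ∈ S.erase e, ¬ e'.IsDiag := fun e' he' => h.nd e' (Finset.mem_of_mem_erase he')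
  set H := SimpleGraph.fromEdgeSet (S : Set (Sym2 V)) with hH
  have hlS : l ∈ H.support := (mem_supp h.nd l).2 ⟨e, he, hle⟩
  let l' : H.support := ⟨l, hlS⟩
  have hadj : ∀ a b : V, H.Adj a b → s(a,b) ∈ S := by
    intro a b hab
    rw [hH, SimpleGraph.fromEdgeSet_adj] at hab
    exact hab.1
  have hconn : (H.induce H.support).Connected := h.conn
  have hpre : ((H.induce H.support).induce ({l'}ᶜ : Set H.support)).Preconnected := by
    apply hconn.preconnected.induce_of_degree_eq_one
    intro v hv
    have : v = l' := by simpa using hv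
    subst this
    intro a ha b hb
    have ha' : s(l, a.1) ∈ S := hadj _ _ ha
    have hb' : s(l, b.1) ∈ S := hadj _ _ hb
    have := leaf_unique hl ha' (by simp) hb' (by simp)
    have := Sym2.congr_right.1 this
    exact Subtype.ext this.symm
  have hcard : H.support.ncard = #S + 1 := h.card
  have hnt : Nontrivial ({l'}ᶜ : Set H.support) := by
    rw [Set.nontrivial_coe_sort, ← Set.one_lt_ncard_iff_nontrivial]
    have := Set.ncard_add_ncard_compl ({l'} : Set H.support)
    rw [Set.ncard_singleton, Nat.card_coe_set_eq] at this
    omega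
  have hsub : ∀ x : ({l'}ᶜ : Set H.support), ∃ y : ({l'}ᶜ : Set H.support),
      s(x.1.1, y.1.1) ∈ S.erase e := by
    intro x
    obtain ⟨y, hy⟩ := hpre.exists_adj_of_nontrivial x
    refine ⟨y, Finset.mem_erase.2 ⟨?_, hadj _ _ hy⟩⟩
    rintro rfl
    simp only [Sym2.mem_iff] at hle
    rcases hle with hle | hle
    · exact x.2 (Subtype.ext hle.symm)
    · exact y.2 (Subtype.ext hle.symm)
  have hmemE : ∀ a b : ({l'}ᶜ : Set H.support), H.Adj a.1.1 b.1.1 → s(a.1.1, b.1.1) ∈ S.erase e := by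
    intro a b hab
    refine Finset.mem_erase.2 ⟨?_, hadj _ _ hab⟩
    rintro rfl
    simp only [Sym2.mem_iff] at hle
    rcases hle with hle | hle
    · exact a.2 (Subtype.ext hle.symm)
    · exact b.2 (Subtype.ext hle.symm)
  have hsuppE : (SimpleGraph.fromEdgeSet ((S.erase e : Finset (Sym2 V)) : Set (Sym2 V))).support =
      H.support \ {l} := by
    ext v
    rw [mem_supp nd']
    constructor
    · rintro ⟨e', he', hv⟩
      refine ⟨(mem_supp h.nd v).2 ⟨e', Finset.mem_of_mem_erase he', hv⟩, ?_⟩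
      rintro rfl
      exact (Finset.mem_erase.1 he').1 (leaf_unique hl he hle (Finset.mem_of_mem_erase he') hv)
    · rintro ⟨hv, hne⟩
      obtain ⟨y, hy⟩ := hsub ⟨⟨v, hv⟩, fun h' => hne (congrArg Subtype.val h')⟩
      exact ⟨_, hy, by simp⟩
  refine ⟨nd', ?_, ?_⟩
  · unfold EdgeSetConnected
    have hc : ((H.induce H.support).induce ({l'}ᶜ : Set H.support)).Connected :=
      (SimpleGraph.connected_iff _).2 ⟨hpre, inferInstance⟩
    let f : ((H.induce H.support).induce ({l'}ᶜ : Set H.support)) →g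
      ((SimpleGraph.fromEdgeSet ((S.erase e : Finset (Sym2 V)) : Set (Sym2 V))).induce
        (SimpleGraph.fromEdgeSet ((S.erase e : Finset (Sym2 V)) : Set (Sym2 V))).support) :=
      { toFun := fun x => ⟨x.1.1, by
          rw [hsuppE]; exact ⟨x.1.2, fun h' => x.2 (Subtype.ext h')⟩⟩
        map_rel' := by
          intro a b hab
          have hab' : H.Adj a.1.1 b.1.1 := hab
          show (SimpleGraph.fromEdgeSet _).Adj a.1.1 b.1.1
          rw [SimpleGraph.fromEdgeSet_adj]
          exact ⟨hmemE a b hab', hab'.ne⟩ }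
    refine SimpleGraph.Connected.map f ?_ hc
    rintro ⟨y, hy⟩
    have hy' := hy
    rw [hsuppE] at hy'
    exact ⟨⟨⟨y, hy'.1⟩, fun h' => hy'.2 (congrArg Subtype.val h')⟩, rfl⟩
  · rw [hsuppE, Set.ncard_sdiff_singleton_of_mem hlS, hcard, Finset.card_erase_of_mem he]
    omega

lemma card_le_of_conn {S : Finset (Sym2 V)} (h : EdgeSetConnected V S) :
    (SimpleGraph.fromEdgeSet (S : Set (Sym2 V))).support.ncard ≤ #S + 1 := by
  have h1 := SimpleGraph.Connected.card_vert_le_card_edgeSet_add_one h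
  rw [Nat.card_coe_set_eq] at h1
  refine h1.trans (Nat.add_le_add_right ?_ 1)
  rw [← Set.ncard_coe_finset S, ← Nat.card_coe_set_eq (S : Set (Sym2 V))]
  have hm : ∀ x : ((SimpleGraph.fromEdgeSet (S : Set (Sym2 V))).induce
      (SimpleGraph.fromEdgeSet (S : Set (Sym2 V))).support).edgeSet,
      Sym2.map Subtype.val x.1 ∈ (S : Set (Sym2 V)) := by
    rintro ⟨x, hx⟩
    induction x using Sym2.ind with
    | _ a b =>
      have : (SimpleGraph.fromEdgeSet (S : Set (Sym2 V))).Adj a.1 b.1 := hx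
      rw [SimpleGraph.fromEdgeSet_adj] at this
      exact this.1
  refine Nat.card_le_card_of_injective (fun x => ⟨_, hm x⟩) ?_
  intro x y hxy
  simp only [Subtype.mk.injEq] at hxy
  exact Subtype.ext (Sym2.map.injective Subtype.val_injective hxy)

/-- non-leaf edges cannot be last -/
lemma cnt_erase_nonleaf {S : Finset (Sym2 V)} (h : TS S) {e : Sym2 V} (he : e ∈ S)
    (hn : ¬ ∃ v ∈ e, dg S v = 1) : cnt (S.erase e) = 0 := by
  have nd' : ∀ e' ∈ S.erase e, ¬ e'.IsDiag := fun e' he' => h.nd e' (Finset.mem_of_mem_erase he')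
  have hex : ∀ v ∈ e, ∃ e' ∈ S.erase e, v ∈ e' := by
    intro v hv
    by_contra hcon
    push Not at hcon
    apply hn
    refine ⟨v, hv, ?_⟩
    rw [dg, Finset.card_eq_one]
    refine ⟨e, ?_⟩
    ext e'
    simp only [Finset.mem_filter, Finset.mem_singleton]
    constructor
    · rintro ⟨h1, h2⟩
      by_contra h3
      exact hcon e' (Finset.mem_erase.2 ⟨h3, h1⟩) h2
    · rintro rfl; exact ⟨he, hv⟩
  apply cnt_eq_zero
  · obtain ⟨e', he', _⟩ := hex _ (Sym2.out_fst_mem e)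
    exact ⟨e', he'⟩
  · intro hc
    have h1 := card_le_of_conn hc
    have h2 : (SimpleGraph.fromEdgeSet ((S.erase e : Finset (Sym2 V)) : Set (Sym2 V))).support =
      (SimpleGraph.fromEdgeSet (S : Set (Sym2 V))).support := by
      ext v
      rw [mem_supp nd', mem_supp h.nd]
      constructor
      · rintro ⟨e', he', hv⟩
        exact ⟨e', Finset.mem_of_mem_erase he', hv⟩
      · rintro ⟨e', he', hv⟩
        by_cases hee : e' = e
        · exact hex v (hee ▸ hv)
        · exact ⟨e', Finset.mem_erase.2 ⟨hee, he'⟩, hv⟩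
    rw [h2, h.card, Finset.card_erase_of_mem he] at h1
    have := Finset.card_pos.2 ⟨e, he⟩
    omega

/-- product of degree factorials -/
def PP (S : Finset (Sym2 V)) : ℕ := ∏ v : V, (dg S v)!

lemma dg_erase {S : Finset (Sym2 V)} {e : Sym2 V} (he : e ∈ S) (v : V) :
    dg S v = dg (S.erase e) v + if v ∈ e then 1 else 0 := by
  unfold dg
  rw [Finset.filter_erase]
  split_ifs with hv
  · rw [Finset.card_erase_of_mem (by simp [he, hv]), Nat.sub_add_cancel]
    exact Finset.card_pos.2 ⟨e, by simp [he, hv]⟩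
  · rw [Finset.erase_eq_of_notMem (by simp [hv]), add_zero]

lemma PP_erase {S : Finset (Sym2 V)} {a b : V} (he : s(a,b) ∈ S) (hab : a ≠ b) :
    PP S = PP (S.erase s(a,b)) * (dg S a * dg S b) := by
  have h1 : ∀ v, (dg S v)! = (dg (S.erase s(a,b)) v)! *
      (if v ∈ ({a, b} : Finset V) then dg S v else 1) := by
    intro v
    have := dg_erase he v
    by_cases hv : v ∈ s(a,b)
    · rw [if_pos hv] at this
      rw [if_pos (by simpa using hv), this, Nat.factorial_succ, mul_comm]
    · rw [if_neg hv] at this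
      rw [if_neg (by simpa using hv), this]; simp
  unfold PP
  rw [Finset.prod_congr rfl (fun v _ => h1 v), Finset.prod_mul_distrib, Finset.prod_ite_mem,
    Finset.univ_inter, Finset.prod_pair hab]

/-- edge weight -/
def xx (S : Finset (Sym2 V)) (e : Sym2 V) : ℚ := ∑ v with v ∈ e, (1 / (dg S v : ℚ)) - 1

lemma xx_mk (S : Finset (Sym2 V)) {a b : V} (hab : a ≠ b) :
    xx S s(a,b) = 1 / dg S a + 1 / dg S b - 1 := by
  have : (Finset.univ.filter fun v => v ∈ s(a,b)) = {a, b} := by ext v; simp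
  rw [xx, this, Finset.sum_pair hab]

lemma sum_xx {S : Finset (Sym2 V)} (h : TS S) : ∑ e ∈ S, xx S e = 1 := by
  unfold xx
  rw [Finset.sum_sub_distrib]
  simp only [Finset.sum_filter]
  rw [Finset.sum_comm]
  have h1 : ∀ v : V, (∑ e ∈ S, if v ∈ e then (1 / (dg S v : ℚ)) else 0) =
      if 0 < dg S v then 1 else 0 := by
    intro v
    rw [← Finset.sum_filter, Finset.sum_const, nsmul_eq_mul]
    change (dg S v : ℚ) * _ = _
    split_ifs with hp
    · field_simp
    · have : dg S v = 0 := by omega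
      simp [this]
  rw [Finset.sum_congr rfl (fun v _ => h1 v), ← Finset.sum_filter, Finset.sum_const, Finset.sum_const]
  have h2 : #{v : V | 0 < dg S v} = #S + 1 := by
    rw [← h.card, ← Set.ncard_coe_finset]
    congr 1
    ext v
    rw [mem_supp h.nd, ← dg_pos]
    simp
  rw [h2]
  simp

def RR (S : Finset (Sym2 V)) : Prop := (∀ v, dg S v ≤ 2) ∨ ∃ c : V, ∀ e ∈ S, c ∈ e
def QQ (S : Finset (Sym2 V)) : Prop :=
  ∀ e ∈ S, (∃ v ∈ e, dg S v = 1) ∨ ∀ v ∈ e, dg S v = 2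

lemma RR.erase {S : Finset (Sym2 V)} (h : RR S) (e : Sym2 V) : RR (S.erase e) := by
  rcases h with h | ⟨c, hc⟩
  · left
    intro v
    refine le_trans ?_ (h v)
    exact Finset.card_le_card (Finset.filter_subset_filter _ (Finset.erase_subset _ _))
  · right
    exact ⟨c, fun e' he' => hc e' (Finset.mem_of_mem_erase he')⟩

lemma RR.QQ {S : Finset (Sym2 V)} (h : RR S) (nd : ∀ e ∈ S, ¬ e.IsDiag) : QQ S := by
  intro e he
  rcases h with h | ⟨c, hc⟩
  · by_cases hl : ∃ v ∈ e, dg S v = 1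
    · exact Or.inl hl
    · right
      intro v hv
      have h1 := h v
      have h2 := (dg_pos (S := S) v).2 ⟨e, he, hv⟩
      have h3 : dg S v ≠ 1 := fun h' => hl ⟨v, hv, h'⟩
      omega
  · left
    obtain ⟨w, rfl⟩ := hc e he
    refine ⟨w, by simp, ?_⟩
    rw [dg, Finset.card_eq_one]
    refine ⟨s(c,w), ?_⟩
    have hcw : c ≠ w := fun h' => nd _ he (by simpa using h')
    ext e'
    simp only [Finset.mem_filter, Finset.mem_singleton]
    constructor
    · rintro ⟨h1, h2⟩
      exact ((Sym2.mem_and_mem_iff hcw).1 ⟨hc _ h1, h2⟩)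
    · rintro rfl; exact ⟨he, by simp⟩

lemma leaf_weight {S : Finset (Sym2 V)} (h : TS S) {e : Sym2 V} (he : e ∈ S)
    (hl : ∃ v ∈ e, dg S v = 1) : (PP (S.erase e) : ℚ) = PP S * xx S e := by
  obtain ⟨a, ⟨b, rfl⟩, ha⟩ := hl
  have hab : a ≠ b := fun h' => h.nd _ he (by simpa using h')
  have hb : 0 < dg S b := (dg_pos b).2 ⟨_, he, by simp⟩
  rw [xx_mk S hab, PP_erase he hab, ha]
  push_cast
  field_simp
  ring

lemma nonleaf_weight {S : Finset (Sym2 V)} (h : TS S) {e : Sym2 V} (he : e ∈ S)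
    (hl : ¬ ∃ v ∈ e, dg S v = 1) : xx S e ≤ 0 ∧ ((∀ v ∈ e, dg S v = 2) → xx S e = 0) ∧
      ((¬ ∀ v ∈ e, dg S v = 2) → xx S e < 0) := by
  induction e using Sym2.ind with
  | _ a b =>
    have hab : a ≠ b := fun h' => h.nd _ he (by simpa using h')
    have hb : 0 < dg S b := (dg_pos b).2 ⟨_, he, by simp⟩
    have ha : 0 < dg S a := (dg_pos a).2 ⟨_, he, by simp⟩
    have hb1 : dg S b ≠ 1 := fun h' => hl ⟨b, by simp, h'⟩
    have ha1 : dg S a ≠ 1 := fun h' => hl ⟨a, by simp, h'⟩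
    have ha2 : 2 ≤ dg S a := by omega
    have hb2 : 2 ≤ dg S b := by omega
    have inv : ∀ n : ℕ, 2 ≤ n → (1 / (n : ℚ)) ≤ 1 / 2 := by
      intro n hn
      have : (2 : ℚ) ≤ n := by exact_mod_cast hn
      exact one_div_le_one_div_of_le (by norm_num) this
    have inv3 : ∀ n : ℕ, 3 ≤ n → (1 / (n : ℚ)) < 1 / 2 := by
      intro n hn
      have : (2 : ℚ) < n := by exact_mod_cast hn
      exact one_div_lt_one_div_of_lt (by norm_num) this
    rw [xx_mk S hab]
    have i1 := inv _ ha2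
    have i2 := inv _ hb2
    refine ⟨by linarith, ?_, ?_⟩
    · intro h2
      rw [h2 a (by simp), h2 b (by simp)]; norm_num
    · intro h2
      by_cases h3 : dg S a = 2
      · have h4 : dg S b ≠ 2 := fun h4 => h2 (by
          intro v hv
          rcases Sym2.mem_iff.1 hv with rfl | rfl <;> assumption)
        have := inv3 (dg S b) (by omega)
        linarith
      · have := inv3 (dg S a) (by omega)
        linarith

lemma main (n : ℕ) : ∀ S : Finset (Sym2 V), #S = n → (S = ∅ ∨ TS S) →
    PP S ≤ cnt S ∧ (RR S → cnt S = PP S) ∧ (¬ QQ S → PP S < cnt S) := by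
  induction n with
  | zero =>
    intro S hS _
    obtain rfl := Finset.card_eq_zero.1 hS
    have : PP (∅ : Finset (Sym2 V)) = 1 := by simp [PP, dg]
    rw [this, cnt_empty]
    exact ⟨le_rfl, fun _ => rfl, fun h => absurd (by intro e he; simp at he) h⟩
  | succ n ih =>
    intro S hS hT
    have hne : S.Nonempty := Finset.card_pos.1 (by omega)
    have hT : TS S := hT.resolve_left hne.ne_empty
    have hrec : (cnt S : ℚ) = ∑ e ∈ S, (cnt (S.erase e) : ℚ) := by
      rw [cnt_rec hne hT.conn]; push_cast; rfl
    have hP : (PP S : ℚ) = ∑ e ∈ S, PP S * xx S e := by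
      rw [← Finset.mul_sum, sum_xx hT, mul_one]
    have hPpos : (0 : ℚ) < PP S := by
      have : 0 < PP S := Finset.prod_pos fun v _ => Nat.factorial_pos _
      exact_mod_cast this
    have hleaf : ∀ e ∈ S, (∃ v ∈ e, dg S v = 1) → PP (S.erase e) ≤ cnt (S.erase e) ∧
        (RR (S.erase e) → cnt (S.erase e) = PP (S.erase e)) := by
      rintro e he ⟨v, hv, hl⟩
      have hc : #(S.erase e) = n := by rw [Finset.card_erase_of_mem he]; omega
      have := ih (S.erase e) hc (by
        rcases Nat.eq_zero_or_pos n with h0 | h0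
        · left; exact Finset.card_eq_zero.1 (hc.trans h0)
        · right; exact supp_erase_leaf hT hl he hv (by omega))
      exact ⟨this.1, this.2.1⟩
    have hle : ∀ e ∈ S, PP S * xx S e ≤ (cnt (S.erase e) : ℚ) := by
      intro e he
      by_cases hl : ∃ v ∈ e, dg S v = 1
      · rw [← leaf_weight hT he hl]
        exact_mod_cast (hleaf e he hl).1
      · rw [cnt_erase_nonleaf hT he hl]
        have := (nonleaf_weight hT he hl).1
        push_cast
        exact mul_nonpos_of_nonneg_of_nonpos hPpos.le this
    refine ⟨?_, ?_, ?_⟩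
    · have : (PP S : ℚ) ≤ cnt S := by
        rw [hrec, hP]; exact Finset.sum_le_sum hle
      exact_mod_cast this
    · intro hR
      have : (cnt S : ℚ) = PP S := by
        rw [hrec, hP]
        refine Finset.sum_congr rfl fun e he => ?_
        by_cases hl : ∃ v ∈ e, dg S v = 1
        · rw [← leaf_weight hT he hl, (hleaf e he hl).2 (hR.erase e)]
        · rw [cnt_erase_nonleaf hT he hl,
            (nonleaf_weight hT he hl).2.1 ((hR.QQ hT.nd e he).resolve_left hl)]
          simp
      exact_mod_cast this
    · intro hQ
      have : (PP S : ℚ) < cnt S := by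
        rw [hrec, hP]
        unfold QQ at hQ
        push Not at hQ
        obtain ⟨e, he, hl, h2⟩ := hQ
        have hl' : ¬ ∃ v ∈ e, dg S v = 1 := by push Not; exact hl
        refine Finset.sum_lt_sum hle ⟨e, he, ?_⟩
        rw [cnt_erase_nonleaf hT he hl']
        have := (nonleaf_weight hT he hl').2.2 (by push Not; exact h2)
        push_cast
        exact mul_neg_of_pos_of_neg hPpos this
      exact_mod_cast this

end Shell

/-- For any tree `T` on `n ≥ 2` vertices, `F(T) ≥ ∏_v d(v)!`, with equality iff
`T` is a path (all degrees at most 2) or a star (some vertex lies on every edge). -/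
theorem prod_degree_factorial_le_shellingCount {V : Type*} [Fintype V]
    (G : SimpleGraph V) [DecidableRel G.Adj] (hT : G.IsTree)
    (hn : 2 ≤ Fintype.card V) :
    (∏ v : V, (G.degree v)!) ≤ shellingCount G ∧
      (shellingCount G = ∏ v : V, (G.degree v)! ↔
        ((∀ v : V, G.degree v ≤ 2) ∨ ∃ c : V, ∀ e ∈ G.edgeSet, c ∈ e)) := by
  classical
  have hdg : ∀ v, Shell.dg G.edgeFinset v = G.degree v := by
    intro v
    rw [← SimpleGraph.card_incidenceFinset_eq_degree, SimpleGraph.incidenceFinset_eq_filter]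
    rfl
  have hPP : ∏ v : V, (G.degree v)! = Shell.PP G.edgeFinset := by
    unfold Shell.PP
    exact Finset.prod_congr rfl fun v _ => by rw [hdg]
  have hR : Shell.RR G.edgeFinset ↔
      ((∀ v : V, G.degree v ≤ 2) ∨ ∃ c : V, ∀ e ∈ G.edgeSet, c ∈ e) := by
    unfold Shell.RR
    simp only [hdg, SimpleGraph.mem_edgeFinset]
  have hnt : Nontrivial V := Fintype.one_lt_card_iff_nontrivial.1 hn
  have hsupp : G.support = Set.univ := hT.connected.preconnected.support_eq_univ
  have hTS : Shell.TS G.edgeFinset := by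
    refine ⟨?_, ?_, ?_⟩
    · intro e he
      exact G.not_isDiag_of_mem_edgeSet (SimpleGraph.mem_edgeFinset.1 he)
    · unfold EdgeSetConnected
      rw [SimpleGraph.coe_edgeFinset, SimpleGraph.fromEdgeSet_edgeSet, hsupp]
      exact (SimpleGraph.induceUnivIso G).connected_iff.2 hT.connected
    · rw [SimpleGraph.coe_edgeFinset, SimpleGraph.fromEdgeSet_edgeSet, hsupp, Set.ncard_univ,
        Nat.card_eq_fintype_card, hT.card_edgeFinset]
  have hm := Shell.main _ G.edgeFinset rfl (Or.inr hTS)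
  rw [hPP, Shell.shellingCount_eq G G.edgeFinset (fun e => SimpleGraph.mem_edgeFinset), ← hR]
  refine ⟨hm.1, ?_, hm.2.1⟩
  intro heq
  have hQ : Shell.QQ G.edgeFinset := by
    by_contra hQ
    have := hm.2.2 hQ
    omega
  by_cases hd : ∀ v, G.degree v ≤ 2
  · left; intro v; rw [hdg]; exact hd v
  · right
    push Not at hd
    obtain ⟨c, hc⟩ := hd
    have hleaf : ∀ w, G.Adj c w → G.degree w = 1 := by
      intro w hw
      rcases hQ s(c,w) (by simpa using hw) with ⟨v, hv, h1⟩ | h2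
      · rw [hdg] at h1
        rcases Sym2.mem_iff.1 hv with rfl | rfl
        · omega
        · exact h1
      · have := h2 c (by simp)
        rw [hdg] at this
        omega
    have huniq : ∀ w, G.Adj c w → ∀ u, G.Adj w u → u = c := by
      intro w hw u hu
      have h1 : #(G.neighborFinset w) ≤ 1 := (hleaf w hw).le
      exact Finset.card_le_one.1 h1 _ (by simpa using hu) _ (by simpa using hw.symm)
    have hall : ∀ w, w = c ∨ G.Adj c w := by
      intro w
      have hreach := (SimpleGraph.reachable_iff_reflTransGen c w).1 (hT.connected.preconnected c w)
      induction hreach with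
      | refl => exact Or.inl rfl
      | tail _ hbc ih =>
        rcases ih with rfl | ih
        · exact Or.inr hbc
        · exact Or.inl (huniq _ ih _ hbc)
    refine ⟨c, ?_⟩
    intro e he
    induction e using Sym2.ind with
    | _ a b =>
      have hab : G.Adj a b := by simpa using he
      rcases hall a with rfl | ha
      · simp
      · rw [huniq a ha b hab]; simp
end

section
/- For any tree T on n ≥ 2 vertices, F(T) ≥ ∏_{v ∈ V(T)} (d(v) - 1)!, where d(v) is the degree of v and F(T) is the number of shellings of T. -/
open SimpleGraph Finset Nat

section Helpers
open Classical

/-- Reversed shellings as lists: the head is the last edge. -/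
def GoodList {V : Type*} : List (Sym2 V) → Prop
  | [] => True
  | e :: l => (l = [] ∨ ∃ f ∈ l, ∃ v, v ∈ e ∧ v ∈ f) ∧ GoodList l

/-- Insert `e` just before the first occurrence of `f`. -/
noncomputable def insAt {α : Type*} (e f : α) : List α → List α
  | [] => []
  | x :: xs => if x = f then e :: x :: xs else x :: insAt e f xs

theorem insAt_perm {α : Type*} (e f : α) (l : List α) (hf : f ∈ l) :
    (insAt e f l).Perm (e :: l) := by
  induction l with
  | nil => simp at hf
  | cons x xs ih =>
    by_cases h : x = f
    · simp [insAt, h]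
    · have hf' : f ∈ xs := by
        rcases List.mem_cons.1 hf with h' | h'
        · exact absurd h'.symm h
        · exact h'
      simp only [insAt, h, if_false]
      exact ((ih hf').cons x).trans (List.Perm.swap e x xs)

theorem insAt_erase {α : Type*} (e f : α) (l : List α) (hf : f ∈ l) (he : e ∉ l) :
    (insAt e f l).erase e = l := by
  induction l with
  | nil => simp at hf
  | cons x xs ih =>
    by_cases h : x = f
    · simp [insAt, h]
    · have hx : x ≠ e := by rintro rfl; simp at he
      have hf' : f ∈ xs := by
        rcases List.mem_cons.1 hf with h' | h'
        · exact absurd h'.symm h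
        · exact h'
      simp only [insAt, h, if_false]
      rw [List.erase_cons_tail (by simpa using hx), ih hf' (fun h => he (List.mem_cons_of_mem _ h))]

theorem insAt_inj {α : Type*} (e f f' : α) (l : List α) (hf : f ∈ l) (hf' : f' ∈ l) (he : e ∉ l)
    (h : insAt e f l = insAt e f' l) : f = f' := by
  induction l with
  | nil => simp at hf
  | cons x xs ih =>
    have hx : x ≠ e := by rintro rfl; simp at he
    have he' : e ∉ xs := fun h => he (List.mem_cons_of_mem _ h)
    by_cases h1 : x = f <;> by_cases h2 : x = f'
    · rw [← h1, ← h2]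
    · simp only [insAt, h1, h2, if_true, if_false] at h
      grind
    · simp only [insAt, h1, h2, if_true, if_false] at h
      grind
    · simp only [insAt, h1, h2, if_false] at h
      exact ih (by grind) (by grind) he' (by simpa using h)

theorem insAt_good {V : Type*} (e f : Sym2 V) (u : V) (hue : u ∈ e) (huf : u ∈ f)
    (l : List (Sym2 V)) (hf : f ∈ l) (hl : GoodList l) : GoodList (insAt e f l) := by
  induction l with
  | nil => simp at hf
  | cons x xs ih =>
    by_cases h : x = f
    · simp only [insAt, h, if_true]
      refine ⟨Or.inr ⟨f, by simp, u, hue, huf⟩, ?_⟩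
      rw [← h]; exact hl
    · have hf' : f ∈ xs := by
        rcases List.mem_cons.1 hf with h' | h'
        · exact absurd h'.symm h
        · exact h'
      simp only [insAt, h, if_false]
      obtain ⟨h1, h2⟩ := hl
      refine ⟨Or.inr ?_, ih hf' h2⟩
      rcases h1 with h1 | ⟨g, hg, v, hv⟩
      · subst h1; simp at hf'
      · exact ⟨g, (insAt_perm e f xs hf').mem_iff.2 (List.mem_cons_of_mem _ hg), v, hv⟩

/-- The finite set of reversed shellings of an edge set. -/
noncomputable def shellLists {V : Type*} (S : Finset (Sym2 V)) : Finset (List (Sym2 V)) :=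
  S.val.lists.toFinset.filter GoodList

theorem mem_shellLists {V : Type*} (S : Finset (Sym2 V)) (l : List (Sym2 V)) :
    l ∈ shellLists S ↔ S.val = (l : Multiset (Sym2 V)) ∧ GoodList l := by
  simp [shellLists, Multiset.mem_lists_iff]

/-- The degree in an edge set. -/
noncomputable def sdeg {V : Type*} (S : Finset (Sym2 V)) (v : V) : ℕ := #{e ∈ S | v ∈ e}

theorem shellLists_insert {V : Type*} (S : Finset (Sym2 V)) (e : Sym2 V) (he : e ∉ S) (u : V)
    (hu : u ∈ e) : sdeg S u * #(shellLists S) ≤ #(shellLists (insert e S)) := by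
  unfold sdeg
  rw [← Finset.card_product]
  have key : ∀ p ∈ ({f ∈ S | u ∈ f} ×ˢ shellLists S),
      p.1 ∈ p.2 ∧ e ∉ p.2 ∧ u ∈ p.1 ∧ S.val = (p.2 : Multiset (Sym2 V)) ∧ GoodList p.2 := by
    rintro ⟨f, l⟩ hp
    simp only [Finset.mem_product, Finset.mem_filter, mem_shellLists] at hp
    obtain ⟨⟨h1, h2⟩, h3, h4⟩ := hp
    refine ⟨?_, ?_, h2, h3, h4⟩
    · rw [← Finset.mem_val, h3] at h1; simpa using h1
    · rw [← Finset.mem_val, h3] at he; simpa using he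
  apply Finset.card_le_card_of_injOn (fun p => insAt e p.1 p.2)
  · intro p hp
    obtain ⟨h1, h2, h3, h4, h5⟩ := key p hp
    simp only [Finset.mem_coe, mem_shellLists]
    refine ⟨?_, insAt_good e p.1 u hu h3 _ h1 h5⟩
    rw [Finset.insert_val_of_notMem he, h4, Multiset.cons_coe, Multiset.coe_eq_coe]
    exact (insAt_perm e p.1 p.2 h1).symm
  · rintro ⟨f, l⟩ hp ⟨f', l'⟩ hp' h
    obtain ⟨h1, h2, -⟩ := key _ hp
    obtain ⟨h1', h2', -⟩ := key _ hp'
    simp only at h h1 h2 h1' h2'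
    have hl : l = l' := by
      rw [← insAt_erase e f l h1 h2, h, insAt_erase e f' l' h1' h2']
    subst hl
    rw [insAt_inj e f f' l h1 h1' h2 h]

/-- Edge sets of trees, built by adding leaves. -/
inductive TreeSet {V : Type*} : Finset (Sym2 V) → Finset V → Prop
  | single (a b : V) (h : a ≠ b) : TreeSet {s(a, b)} {a, b}
  | leaf (S : Finset (Sym2 V)) (W : Finset V) (u l : V) (h : TreeSet S W) (hu : u ∈ W)
      (hl : l ∉ W) : TreeSet (insert s(u, l) S) (insert l W)

theorem TreeSet.supp {V : Type*} {S : Finset (Sym2 V)} {W : Finset V} (h : TreeSet S W) :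
    ∀ v, v ∈ W ↔ 0 < sdeg S v := by
  induction h with
  | single a b h =>
    intro v
    simp only [sdeg, Finset.card_pos, Finset.filter_nonempty_iff]
    simp
  | leaf S W u l h hu hl ih =>
    intro v
    have := ih v
    have := ih u
    simp only [sdeg, Finset.card_pos, Finset.filter_nonempty_iff] at *
    simp only [Finset.mem_insert, exists_eq_or_imp, Sym2.mem_iff]
    grind

theorem TreeSet.notMem {V : Type*} {S : Finset (Sym2 V)} {W : Finset V} (h : TreeSet S W)
    (u l : V) (hl : l ∉ W) : s(u, l) ∉ S := by
  intro hm
  apply hl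
  rw [h.supp, sdeg, Finset.card_pos]
  exact ⟨s(u, l), by simp [hm]⟩

theorem TreeSet.card {V : Type*} {S : Finset (Sym2 V)} {W : Finset V} (h : TreeSet S W) :
    #S + 1 = #W := by
  induction h with
  | single a b h => simp [Finset.card_pair h]
  | leaf S W u l h hu hl ih =>
    rw [Finset.card_insert_of_notMem (h.notMem u l hl), Finset.card_insert_of_notMem hl, ih]

theorem TreeSet.bound {V : Type*} [Fintype V] {S : Finset (Sym2 V)} {W : Finset V}
    (h : TreeSet S W) : ∏ v : V, (sdeg S v - 1)! ≤ #(shellLists S) := by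
  induction h with
  | single a b h =>
    have h1 : ∀ v : V, (sdeg {s(a, b)} v - 1)! = 1 := by
      intro v
      have : sdeg {s(a, b)} v ≤ 1 := by
        unfold sdeg
        exact (Finset.card_filter_le _ _).trans (by simp)
      rw [Nat.sub_eq_zero_of_le this]; rfl
    simp only [h1, Finset.prod_const_one]
    apply Finset.card_pos.2
    exact ⟨[s(a, b)], by rw [mem_shellLists]; simp [GoodList]⟩
  | leaf S W u l h hu hl ih =>
    have hne := h.notMem u l hl
    refine le_trans ?_ (shellLists_insert S s(u, l) hne u (by simp))
    refine le_trans (le_of_eq ?_) (Nat.mul_le_mul_left _ ih)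
    have hul : u ≠ l := by rintro rfl; exact hl hu
    have hd : ∀ v, sdeg (insert s(u, l) S) v = sdeg S v + if v = u ∨ v = l then 1 else 0 := by
      intro v
      unfold sdeg
      rw [Finset.filter_insert]
      simp only [Sym2.mem_iff]
      split_ifs
      · rw [Finset.card_insert_of_notMem (by simp [hne])]
      · rfl
    have h0 : sdeg S l = 0 := by
      have := h.supp l
      grind
    have hup := (h.supp u).1 hu
    have : ∀ v, (sdeg (insert s(u, l) S) v - 1)! =
        (if v = u then sdeg S u else 1) * (sdeg S v - 1)! := by
      intro v
      rw [hd]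
      by_cases h1 : v = u
      · subst h1
        simp [Nat.mul_factorial_pred hup.ne']
      · by_cases h2 : v = l
        · subst h2; simp [h1, h0]
        · simp [h1, h2]
    simp only [this, Finset.prod_mul_distrib]
    simp

theorem exists_treeSet {V : Type*} [Fintype V] (G : SimpleGraph V) (hT : G.IsTree)
    (hn : 2 ≤ Fintype.card V) (k : ℕ) (hk : 2 ≤ k) (hk' : k ≤ Fintype.card V) :
    ∃ S W, TreeSet S W ∧ S ⊆ G.edgeFinset ∧ #W = k := by
  induction k, hk using Nat.le_induction with
  | base =>
    have : Nontrivial V := Fintype.one_lt_card_iff_nontrivial.1 hn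
    obtain ⟨a⟩ := hT.1.nonempty
    obtain ⟨b, hb⟩ := hT.1.preconnected.exists_adj_of_nontrivial a
    exact ⟨_, _, TreeSet.single a b hb.ne, by simpa using hb, Finset.card_pair hb.ne⟩
  | succ k hk ih =>
    obtain ⟨S, W, h, hS, hW⟩ := ih (by omega)
    have hne : W.Nonempty := Finset.card_pos.1 (by omega)
    obtain ⟨a, ha⟩ := hne
    obtain ⟨b, hb⟩ : ∃ b, b ∉ W := by
      by_contra! hc
      have : W = Finset.univ := by ext; simp [hc]
      rw [this, Finset.card_univ] at hW
      omega
    obtain ⟨p⟩ := hT.1.preconnected a b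
    obtain ⟨d, hd, hd1, hd2⟩ := p.exists_boundary_dart (W : Set V) ha hb
    refine ⟨_, _, TreeSet.leaf S W d.fst d.snd h hd1 hd2, ?_, ?_⟩
    · rw [Finset.insert_subset_iff]
      exact ⟨by simpa using d.adj, hS⟩
    · rw [Finset.card_insert_of_notMem hd2, hW]

theorem tree_bound {V : Type*} [Fintype V] (G : SimpleGraph V) (hT : G.IsTree)
    (hn : 2 ≤ Fintype.card V) :
    ∏ v : V, (sdeg G.edgeFinset v - 1)! ≤ #(shellLists G.edgeFinset) := by
  obtain ⟨S, W, h, hS, hW⟩ := exists_treeSet G hT hn _ hn le_rfl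
  have hc := h.card
  have := hT.card_edgeFinset
  have : S = G.edgeFinset := Finset.eq_of_subset_of_card_le hS (by omega)
  rw [← this]
  exact h.bound

theorem edgeSetConnected_of_s13 {V : Type*} (S : Set (Sym2 V)) (a : V)
    (ha : a ∈ (fromEdgeSet S).support)
    (h : ∀ b ∈ (fromEdgeSet S).support, (fromEdgeSet S).Reachable a b) :
    EdgeSetConnected V S := by
  have key : ∀ (x y : V) (p : (fromEdgeSet S).Walk x y) (hx : x ∈ (fromEdgeSet S).support)
      (hy : y ∈ (fromEdgeSet S).support),
      ((fromEdgeSet S).induce (fromEdgeSet S).support).Reachable ⟨x, hx⟩ ⟨y, hy⟩ := by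
    intro x y p
    induction p with
    | nil => intro _ _; exact Reachable.refl _
    | cons hadj p ih =>
      intro hx hy
      have hz := (SimpleGraph.mem_support _).2 ⟨_, hadj.symm⟩
      refine Reachable.trans (Adj.reachable ?_) (ih hz hy)
      exact hadj
  unfold EdgeSetConnected
  rw [SimpleGraph.connected_iff_exists_forall_reachable]
  refine ⟨⟨a, ha⟩, ?_⟩
  rintro ⟨b, hb⟩
  obtain ⟨p⟩ := h b hb
  exact key _ _ p ha hb

theorem mem_supp_iff {V : Type*} (S : Set (Sym2 V)) (hS : ∀ e ∈ S, ¬ e.IsDiag) (v : V) :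
    v ∈ (fromEdgeSet S).support ↔ ∃ e ∈ S, v ∈ e := by
  rw [SimpleGraph.mem_support]
  constructor
  · rintro ⟨w, hw⟩
    rw [fromEdgeSet_adj] at hw
    exact ⟨_, hw.1, by simp⟩
  · rintro ⟨e, he, hv⟩
    obtain ⟨w, rfl⟩ := hv
    exact ⟨w, by rw [fromEdgeSet_adj]; exact ⟨he, by simpa using hS _ he⟩⟩

theorem reach_edge {V : Type*} (S : Set (Sym2 V)) (e : Sym2 V) (he : e ∈ S) (a b : V)
    (ha : a ∈ e) (hb : b ∈ e) : (fromEdgeSet S).Reachable a b := by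
  by_cases h : a = b
  · subst h; exact Reachable.refl _
  · have : e = s(a, b) := ((Sym2.mem_and_mem_iff h).1 ⟨ha, hb⟩)
    apply Adj.reachable
    rw [fromEdgeSet_adj]
    exact ⟨this ▸ he, h⟩

theorem good_reach {V : Type*} (l : List (Sym2 V)) (hg : GoodList l) :
    ∀ e ∈ l, ∀ f ∈ l, ∀ a ∈ e, ∀ b ∈ f, (fromEdgeSet {x | x ∈ l}).Reachable a b := by
  induction l with
  | nil => simp
  | cons e l ih =>
    obtain ⟨h1, h2⟩ := hg
    have hmono : ∀ a b, (fromEdgeSet {x | x ∈ l}).Reachable a b →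
        (fromEdgeSet {x | x ∈ e :: l}).Reachable a b := by
      intro a b h
      refine h.mono (fromEdgeSet_mono ?_)
      intro x hx
      exact List.mem_cons_of_mem _ hx
    have hnew : ∀ f ∈ l, ∀ a ∈ e, ∀ b ∈ f,
        (fromEdgeSet {x | x ∈ e :: l}).Reachable a b := by
      intro f hf a ha b hb
      rcases h1 with h1 | ⟨g, hg, v, hv, hv'⟩
      · subst h1; simp at hf
      · exact (reach_edge _ e (by simp) a v ha hv).trans
          (hmono _ _ (ih h2 g hg f hf v hv' b hb))
    intro f hf g hg a ha b hb
    rcases List.mem_cons.1 hf with hfe | hf <;>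
      rcases List.mem_cons.1 hg with hge | hg
    · exact reach_edge _ e (by simp) a b (hfe ▸ ha) (hge ▸ hb)
    · exact hnew g hg a (hfe ▸ ha) b hb
    · exact (hnew f hf b (hge ▸ hb) a ha).symm
    · exact hmono _ _ (ih h2 f hf g hg a ha b hb)

theorem good_connected {V : Type*} (l : List (Sym2 V)) (hg : GoodList l) (hne : l ≠ [])
    (hd : ∀ e ∈ l, ¬ e.IsDiag) : EdgeSetConnected V {x | x ∈ l} := by
  obtain ⟨e, he⟩ := List.exists_mem_of_ne_nil l hne
  obtain ⟨a, ha⟩ : ∃ a, a ∈ e := by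
    induction e with | _ x y => exact ⟨x, by simp⟩
  refine edgeSetConnected_of_s13 _ a ((mem_supp_iff _ hd a).2 ⟨e, he, ha⟩) ?_
  intro b hb
  obtain ⟨f, hf, hbf⟩ := (mem_supp_iff _ hd b).1 hb
  exact good_reach l hg e he f hf a ha b hbf

theorem GoodList.drop {V : Type*} (l : List (Sym2 V)) (hg : GoodList l) (k : ℕ) :
    GoodList (l.drop k) := by
  induction l generalizing k with
  | nil => simp [GoodList]
  | cons e l ih =>
    cases k with
    | zero => exact hg
    | succ k => exact ih hg.2 k

theorem shellLists_card_le {V : Type*} [Fintype V] (G : SimpleGraph V) :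
    #(shellLists G.edgeFinset) ≤ shellingCount G := by
  have hm : Nat.card G.edgeSet = #G.edgeFinset := by
    rw [Nat.card_eq_fintype_card, edgeFinset_card]
  have key : ∀ l ∈ shellLists G.edgeFinset,
      ∃ σ : Fin (Nat.card G.edgeSet) ≃ G.edgeSet, IsShelling G σ ∧
        List.ofFn (fun i => (σ i : Sym2 V)) = l.reverse := by
    intro l hl
    rw [mem_shellLists] at hl
    obtain ⟨h1, h2⟩ := hl
    have hmem : ∀ e, e ∈ l ↔ e ∈ G.edgeSet := by
      intro e
      rw [← mem_edgeFinset, ← Finset.mem_val, h1, Multiset.mem_coe]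
    have hnd : l.Nodup := by
      have := G.edgeFinset.nodup
      rw [h1] at this
      simpa using this
    have hlen : l.length = Nat.card G.edgeSet := by
      rw [hm, Finset.card_def, h1, Multiset.coe_card]
    have hlen' : l.reverse.length = Nat.card G.edgeSet := by simpa using hlen
    let g : Fin (Nat.card G.edgeSet) → G.edgeSet := fun i =>
      ⟨l.reverse[i.1]'(by rw [hlen']; exact i.2), by
        rw [← hmem, ← List.mem_reverse]; exact List.getElem_mem _⟩
    have hinj : Function.Injective g := by
      intro i j hij
      have := congrArg Subtype.val hij
      simp only [g] at this
      exact Fin.ext ((List.nodup_reverse.2 hnd).getElem_inj_iff.1 this)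
    have hsurj : Function.Surjective g := by
      rintro ⟨e, he⟩
      rw [← hmem, ← List.mem_reverse] at he
      obtain ⟨i, hi, h⟩ := List.getElem_of_mem he
      exact ⟨⟨i, hlen' ▸ hi⟩, Subtype.ext h⟩
    refine ⟨Equiv.ofBijective g ⟨hinj, hsurj⟩, ?_, ?_⟩
    · intro k
      have hset : {e | ∃ i, i ≤ k ∧ ((Equiv.ofBijective g ⟨hinj, hsurj⟩) i : Sym2 V) = e} =
          {x | x ∈ l.drop (l.length - (k.1 + 1))} := by
        ext e
        simp only [Set.mem_ofPred_eq]
        rw [← List.mem_reverse, List.reverse_drop, List.mem_take_iff_getElem]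
        have hk := k.2
        constructor
        · rintro ⟨i, hi, rfl⟩
          have hi' : i.1 ≤ k.1 := hi
          exact ⟨i.1, by omega, rfl⟩
        · rintro ⟨i, hi, rfl⟩
          exact ⟨⟨i, by omega⟩, by show i ≤ k.1; omega, rfl⟩
      rw [hset]
      have hk := k.2
      refine good_connected _ (h2.drop _ _) ?_ ?_
      · intro h0
        have := congrArg List.length h0
        simp at this
        omega
      · intro e he
        exact G.not_isDiag_of_mem_edgeSet ((hmem e).1 (List.mem_of_mem_drop he))
    · apply List.ext_getElem
      · simp [hlen]
      · intro i _ _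
        rw [List.getElem_ofFn]
        rfl
  choose σ hσ1 hσ2 using key
  unfold shellingCount
  rw [← Nat.card_eq_finsetCard]
  refine Nat.card_le_card_of_injective
    (fun l : shellLists G.edgeFinset => ⟨σ l.1 l.2, hσ1 l.1 l.2⟩) ?_
  intro l l' h
  have h' : σ l.1 l.2 = σ l'.1 l'.2 := congrArg Subtype.val h
  apply Subtype.ext
  apply List.reverse_injective
  rw [← hσ2 l.1 l.2, ← hσ2 l'.1 l'.2, h']

end Helpers

/-- For any tree `T` on `n ≥ 2` vertices, `F(T) ≥ ∏_v (d(v)-1)!`. -/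
theorem prod_degree_sub_one_factorial_le_shellingCount {V : Type*} [Fintype V]
    (G : SimpleGraph V) [DecidableRel G.Adj] (hT : G.IsTree)
    (hn : 2 ≤ Fintype.card V) :
    (∏ v : V, (G.degree v - 1)!) ≤ shellingCount G := by
  classical
  refine le_trans (le_of_eq ?_) ((tree_bound G hT hn).trans (shellLists_card_le G))
  refine Finset.prod_congr rfl fun v _ => ?_
  have : G.degree v = sdeg G.edgeFinset v := by
    rw [← card_incidenceFinset_eq_degree, incidenceFinset_eq_filter]
    unfold sdeg
    congr!
  rw [this]
  congr!
end
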